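/- Every finitely generated torsion-free solvable subgroup of IET is virtually abelian, i.e. contains an abelian subgroup of finite index. -/

import Mathlib

/-- The half-open unit interval `[0,1)` as a subset of `ℝ`. -/
abbrev I01 : Set ℝ := Set.Ico (0 : ℝ) 1

/-- A bijection of `[0,1)` is an interval exchange transformation if there are finitely many
points `0 = a 0 < a 1 < … < a n = 1` such that on each `[a i, a (i+1))` it is a translation. -/
def IsIET (T : Equiv.Perm I01) : Prop :=
  ∃ (n : ℕ) (a : Fin (n + 1) → ℝ), StrictMono a ∧ a 0 = 0 ∧ a (Fin.last n) = 1 ∧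
    ∀ i : Fin n, ∃ c : ℝ, ∀ x : I01, (x : ℝ) ∈ Set.Ico (a i.castSucc) (a i.succ) →
      ((T x : ℝ)) = (x : ℝ) + c

section IETProof

open scoped Pointwise Topology
open Filter

/-! ### Step functions and piecewise translations -/

/-- Step functions on `[0,1)`, right-continuous with finitely many jumps. -/
def Step {α : Type*} (f : I01 → α) : Prop :=
  ∃ F : Set I01, F.Finite ∧ ∀ x y : I01, x < y → (∀ z ∈ F, ¬ (x < z ∧ z ≤ y)) → f x = f y

def PW (T : Equiv.Perm I01) : Prop := Step (fun x => (T x : ℝ) - x)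

theorem Step.const {α : Type*} (a : α) : Step (fun _ => a) :=
  ⟨∅, Set.finite_empty, fun _ _ _ _ => rfl⟩

theorem Step.map {α β : Type*} {f : I01 → α} (hf : Step f) (h : α → β) :
    Step (fun x => h (f x)) := by
  obtain ⟨F, hF, h1⟩ := hf
  exact ⟨F, hF, fun x y hxy hz => congrArg h (h1 x y hxy hz)⟩

theorem Step.map₂ {α β γ : Type*} {f : I01 → α} {g : I01 → β} (hf : Step f) (hg : Step g)
    (h : α → β → γ) : Step (fun x => h (f x) (g x)) := by
  obtain ⟨F, hF, h1⟩ := hf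
  obtain ⟨F', hF', h2⟩ := hg
  refine ⟨F ∪ F', hF.union hF', fun x y hxy hz => ?_⟩
  have e1 := h1 x y hxy (fun z hz' => hz z (Or.inl hz'))
  have e2 := h2 x y hxy (fun z hz' => hz z (Or.inr hz'))
  simp only [e1, e2]

theorem Step.comp {α : Type*} {f : I01 → α} (hf : Step f) {T : Equiv.Perm I01} (hT : PW T) :
    Step (fun x => f (T x)) := by
  obtain ⟨F, hF, h1⟩ := hf
  obtain ⟨F', hF', h2⟩ := hT
  refine ⟨F' ∪ T ⁻¹' F, hF'.union (hF.preimage T.injective.injOn), fun x y hxy hz => ?_⟩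
  have e2 := h2 x y hxy (fun z hz' => hz z (Or.inl hz'))
  have hxy' : (x : ℝ) < y := hxy
  simp only at e2
  apply h1
  · show (T x : ℝ) < T y
    linarith
  · rintro w hw ⟨hw1, hw2⟩
    have hw1' : (T x : ℝ) < w := hw1
    have hw2' : (w : ℝ) ≤ T y := hw2
    have hx0 := x.2.1
    have hy1 := y.2.2
    let z : I01 := ⟨x + (w - T x), by constructor <;> linarith⟩
    have hxz : x < z := by
      show (x : ℝ) < x + (w - T x)
      linarith
    have hzy : z ≤ y := by
      show (x : ℝ) + (w - T x) ≤ y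
      linarith
    have e3 := h2 x z hxz (fun u hu hu' => hz u (Or.inl hu) ⟨hu'.1, hu'.2.trans hzy⟩)
    have : T z = w := by
      apply Subtype.ext
      have : (z : ℝ) = x + (w - T x) := rfl
      simp only at e3
      linarith
    exact hz z (Or.inr (by simpa [this] using hw)) ⟨hxz, hzy⟩

theorem PW.one : PW 1 := by
  have := Step.const (0 : ℝ)
  unfold PW
  simpa using this

theorem PW.mul {S T : Equiv.Perm I01} (hS : PW S) (hT : PW T) : PW (S * T) := by
  have := Step.map₂ (Step.comp hS hT) hT (fun a b => a + b)
  unfold PW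
  convert this using 2
  simp

/-- The group of interval exchanges. -/
def IETG : Subgroup (Equiv.Perm I01) where
  carrier := {T | PW T ∧ PW T⁻¹}
  mul_mem' := by
    rintro a b ⟨ha, ha'⟩ ⟨hb, hb'⟩
    exact ⟨ha.mul hb, by rw [mul_inv_rev]; exact hb'.mul ha'⟩
  one_mem' := ⟨PW.one, by rw [inv_one]; exact PW.one⟩
  inv_mem' := by
    rintro a ⟨ha, ha'⟩
    exact ⟨ha', by rwa [inv_inv]⟩

theorem IsIET.pw {T : Equiv.Perm I01} (h : IsIET T) : PW T := by
  obtain ⟨n, a, ha, h0, h1, hc⟩ := h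
  refine ⟨{x | ∃ i, a i = x}, ?_, ?_⟩
  · have : {x : I01 | ∃ i, a i = x} = Subtype.val ⁻¹' (Set.range a) := by
      ext x; simp
    rw [this]
    exact (Set.finite_range a).preimage Subtype.val_injective.injOn
  · intro x y hxy hz
    have hxy' : (x : ℝ) < y := hxy
    -- find the interval containing x
    have : ∃ i : Fin n, a i.castSucc ≤ x ∧ (x : ℝ) < a i.succ := by
      by_contra hcon
      push Not at hcon
      have : ∀ i : Fin (n + 1), a i ≤ x := by
        intro i
        induction i using Fin.induction with
        | zero => rw [h0]; exact x.2.1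
        | succ i ih => exact hcon i ih
      have := this (Fin.last n)
      rw [h1] at this
      exact absurd x.2.2 (not_lt.mpr this)
    obtain ⟨i, hi1, hi2⟩ := this
    obtain ⟨c, hc⟩ := hc i
    have hy : (y : ℝ) < a i.succ := by
      by_contra hcon
      push Not at hcon
      have hx0 := x.2.1
      have hy1 := y.2.2
      exact hz ⟨a i.succ, by constructor <;> linarith⟩ ⟨i.succ, rfl⟩ ⟨hi2, hcon⟩
    have e1 := hc x ⟨hi1, hi2⟩
    have e2 := hc y ⟨by linarith, hy⟩
    simp only
    linarith

/-! ### Left germs -/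

noncomputable def pt (x : I01) : ℝ := if (x : ℝ) = 0 then 1 else x

theorem pt_pos (x : I01) : 0 < pt x := by
  unfold pt; split_ifs with h
  · exact one_pos
  · exact lt_of_le_of_ne x.2.1 (Ne.symm h)

theorem pt_le_one (x : I01) : pt x ≤ 1 := by
  unfold pt; split_ifs with h
  · exact le_rfl
  · exact x.2.2.le

theorem pt_of_pos {x : I01} (h : 0 < (x : ℝ)) : pt x = x := by
  unfold pt; rw [if_neg h.ne']

theorem le_pt (x : I01) : (x : ℝ) ≤ pt x := by
  unfold pt; split_ifs with h
  · rw [h]; exact zero_le_one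
  · exact le_rfl

theorem pt_injective : Function.Injective pt := by
  intro x y h
  have hx := x.2.2
  have hy := y.2.2
  unfold pt at h
  split_ifs at h with h1 h2 h3
  · exact Subtype.ext (h1.trans h2.symm)
  · linarith
  · linarith
  · exact Subtype.ext h

theorem exists_pt {r : ℝ} (h0 : 0 < r) (h1 : r ≤ 1) : ∃ x, pt x = r := by
  rcases h1.lt_or_eq with h | h
  · exact ⟨⟨r, h0.le, h⟩, pt_of_pos h0⟩
  · exact ⟨⟨0, le_rfl, one_pos⟩, by simp [pt, h]⟩

noncomputable def lf (x : I01) : Filter I01 := Filter.comap Subtype.val (𝓝[<] (pt x))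

theorem mem_lf {x : I01} {S : Set I01} :
    S ∈ lf x ↔ ∃ c : ℝ, 0 ≤ c ∧ c < pt x ∧ ∀ y : I01, c < y → (y : ℝ) < pt x → y ∈ S := by
  unfold lf
  rw [Filter.mem_comap]
  constructor
  · rintro ⟨t, ht, hts⟩
    rw [mem_nhdsLT_iff_exists_Ioo_subset' (pt_pos x)] at ht
    obtain ⟨l, hl, hlt⟩ := ht
    refine ⟨max l 0, le_max_right _ _, max_lt hl (pt_pos x), fun y h1 h2 => hts ?_⟩
    exact hlt ⟨(le_max_left _ _).trans_lt h1, h2⟩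
  · rintro ⟨c, -, hc, h⟩
    exact ⟨Set.Ioo c (pt x), Ioo_mem_nhdsLT hc, fun y hy => h y hy.1 hy.2⟩

instance lf_neBot (x : I01) : (lf x).NeBot := by
  constructor
  intro h
  have : (∅ : Set I01) ∈ lf x := by rw [h]; exact Filter.mem_bot
  obtain ⟨c, h0, hc, h1⟩ := mem_lf.1 this
  have := pt_le_one x
  exact h1 ⟨(c + pt x) / 2, by constructor <;> linarith⟩ (by simp only; linarith)
    (by simp only; linarith)

theorem lf_injective : Function.Injective lf := by
  have key : ∀ x y, pt x < pt y → lf x ≠ lf y := by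
    intro x y hxy h
    have h1 : {z : I01 | (z : ℝ) < pt x} ∈ lf x :=
      mem_lf.2 ⟨0, le_rfl, pt_pos x, fun z _ hz => hz⟩
    have h2 : {z : I01 | pt x < (z : ℝ)} ∈ lf y :=
      mem_lf.2 ⟨pt x, (pt_pos x).le, hxy, fun z hz _ => hz⟩
    rw [h] at h1
    obtain ⟨z, hz1, hz2⟩ := (lf_neBot y).nonempty_of_mem (Filter.inter_mem h1 h2)
    exact lt_asymm (show (z : ℝ) < pt x from hz1) hz2
  intro x y h
  rcases lt_trichotomy (pt x) (pt y) with h1 | h1 | h1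
  · exact absurd h (key _ _ h1)
  · exact pt_injective h1
  · exact absurd h.symm (key _ _ h1)

theorem map_lf_eq {g : Equiv.Perm I01} {x y : I01} {c b : ℝ} (hc : c < pt x)
    (h : ∀ z : I01, c < z → (z : ℝ) < pt x → (g z : ℝ) = z + b) (hy : pt y = pt x + b) :
    Filter.map g (lf x) = lf y := by
  ext S
  rw [Filter.mem_map, mem_lf, mem_lf]
  constructor
  · rintro ⟨d, hd0, hd, hS⟩
    refine ⟨max (max c d + b) 0, le_max_right _ _, max_lt ?_ (pt_pos y), fun w h1 h2 => ?_⟩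
    · rw [hy]; have := max_lt hc hd; linarith
    · have h3 := (le_max_left _ _).trans_lt h1
      have h4 := le_max_left c d
      have h5 := le_max_right c d
      have h6 := pt_le_one x
      rw [hy] at h2
      let z : I01 := ⟨w - b, by constructor <;> linarith⟩
      have e := h z (by show c < (w : ℝ) - b; linarith) (by show (w : ℝ) - b < _; linarith)
      have hz := hS z (by show d < (w : ℝ) - b; linarith) (by show (w : ℝ) - b < _; linarith)
      have : g z = w := Subtype.ext (by rw [e]; show (w : ℝ) - b + b = w; ring)
      rw [Set.mem_preimage, this] at hz
      exact hz
  · rintro ⟨d, hd0, hd, hS⟩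
    refine ⟨max (max c (d - b)) 0, le_max_right _ _, max_lt (max_lt hc ?_) (pt_pos x),
      fun w h1 h2 => ?_⟩
    · rw [hy] at hd; linarith
    · have h3 := (le_max_left _ _).trans_lt h1
      have h4 := le_max_left c (d - b)
      have h5 := le_max_right c (d - b)
      have e := h w (by linarith) h2
      exact hS (g w) (by rw [e]; linarith) (by rw [e, hy]; linarith)

/-- a step function is constant slightly to the left of a point -/
theorem Step.left {α : Type*} {f : I01 → α} (hf : Step f) (x : I01) :
    ∃ c : ℝ, 0 ≤ c ∧ c < pt x ∧ ∀ y z : I01, c < y → (y : ℝ) < pt x → c < z → (z : ℝ) < pt x →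
      f y = f z := by
  obtain ⟨F, hF, h⟩ := hf
  have : ∃ c : ℝ, 0 ≤ c ∧ c < pt x ∧ ∀ u ∈ F, (u : ℝ) < pt x → (u : ℝ) ≤ c := by
    clear h
    induction F, hF using Set.Finite.induction_on with
    | empty => exact ⟨0, le_rfl, pt_pos x, by simp⟩
    | @insert a s ha hs ih =>
      obtain ⟨c, h0, h1, h2⟩ := ih
      by_cases hap : (a : ℝ) < pt x
      · refine ⟨max c a, h0.trans (le_max_left _ _), max_lt h1 hap, ?_⟩
        rintro u (rfl | hu) hup
        · exact le_max_right _ _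
        · exact (h2 u hu hup).trans (le_max_left _ _)
      · refine ⟨c, h0, h1, ?_⟩
        rintro u (rfl | hu) hup
        · exact absurd hup hap
        · exact h2 u hu hup
  obtain ⟨c, h0, h1, h2⟩ := this
  have key : ∀ y z : I01, y < z → c < y → (z : ℝ) < pt x → f y = f z := by
    intro y z hyz hcy hz
    apply h _ _ hyz
    rintro u hu ⟨hu1, hu2⟩
    have hu1' : (y : ℝ) < u := hu1
    have hu2' : (u : ℝ) ≤ z := hu2
    have := h2 u hu (by linarith)
    linarith
  refine ⟨c, h0, h1, fun y z hy1 hy2 hz1 hz2 => ?_⟩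
  rcases lt_trichotomy y z with hh | hh | hh
  · exact key y z hh hy1 hz2
  · rw [hh]
  · exact (key z y hh hz1 hy2).symm

theorem Step.exists_left {α : Type*} {f : I01 → α} (hf : Step f) (x : I01) :
    ∃ v, ∀ᶠ y in lf x, f y = v := by
  obtain ⟨c, h0, h1, h⟩ := hf.left x
  have := pt_le_one x
  let w : I01 := ⟨(c + pt x) / 2, by constructor <;> linarith⟩
  refine ⟨f w, mem_lf.2 ⟨c, h0, h1, fun y hy1 hy2 => h y w hy1 hy2 ?_ ?_⟩⟩
  · show c < (c + pt x) / 2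
    linarith
  · show (c + pt x) / 2 < pt x
    linarith

theorem Step.finite_jump {α : Type*} {f : I01 → α} (hf : Step f) :
    {x | ¬ ∀ᶠ y in lf x, f y = f x}.Finite := by
  have hf' := hf
  obtain ⟨F, hF, h⟩ := hf
  refine (hF.insert ⟨0, le_rfl, one_pos⟩).subset ?_
  intro x hx
  by_contra hcon
  rw [Set.mem_insert_iff, not_or] at hcon
  obtain ⟨hx0, hxF⟩ := hcon
  apply hx
  have hxp : 0 < (x : ℝ) := lt_of_le_of_ne x.2.1 (fun h' => hx0 (Subtype.ext h'.symm))
  have : ∃ c : ℝ, 0 ≤ c ∧ c < x ∧ ∀ u ∈ F, (u : ℝ) < x → (u : ℝ) ≤ c := by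
    clear h hxF
    induction F, hF using Set.Finite.induction_on with
    | empty => exact ⟨0, le_rfl, hxp, by simp⟩
    | @insert a s ha hs ih =>
      obtain ⟨c, h0, h1, h2⟩ := ih
      by_cases hap : (a : ℝ) < x
      · refine ⟨max c a, h0.trans (le_max_left _ _), max_lt h1 hap, ?_⟩
        rintro u (rfl | hu) hup
        · exact le_max_right _ _
        · exact (h2 u hu hup).trans (le_max_left _ _)
      · refine ⟨c, h0, h1, ?_⟩
        rintro u (rfl | hu) hup
        · exact absurd hup hap
        · exact h2 u hu hup
  obtain ⟨c, h0, h1, h2⟩ := this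
  refine mem_lf.2 ⟨c, h0, by rwa [pt_of_pos hxp], fun y hy1 hy2 => ?_⟩
  rw [pt_of_pos hxp] at hy2
  refine h y x hy2 ?_
  rintro u hu ⟨hu1, hu2⟩
  have hu1' : (y : ℝ) < u := hu1
  have : u ≠ x := fun h' => hxF (h' ▸ hu)
  have hu2' : (u : ℝ) < x := lt_of_le_of_ne hu2 (fun h' => this (Subtype.ext h'))
  have := h2 u hu hu2'
  linarith

theorem exists_lmap {g : Equiv.Perm I01} (hg : PW g) (x : I01) :
    ∃ y, Filter.map g (lf x) = lf y := by
  obtain ⟨b, hb⟩ := Step.exists_left hg x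
  obtain ⟨c, h0, h1, h⟩ := mem_lf.1 hb
  have hp := pt_le_one x
  have hc : ∀ z : I01, c < z → (z : ℝ) < pt x → (g z : ℝ) = z + b := by
    intro z hz1 hz2
    have : (g z : ℝ) - z = b := h z hz1 hz2
    linarith
  have hpos : 0 < pt x + b := by
    let w : I01 := ⟨(c + pt x) / 2, by constructor <;> linarith⟩
    have hw : (w : ℝ) = (c + pt x) / 2 := rfl
    have := hc w (by rw [hw]; linarith) (by rw [hw]; linarith)
    have := (g w).2.1
    linarith
  have hle : pt x + b ≤ 1 := by
    by_contra hcon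
    push Not at hcon
    let w : I01 := ⟨max ((c + pt x) / 2) (1 - b), by
      constructor
      · exact le_trans (by linarith) (le_max_left _ _)
      · apply max_lt <;> linarith⟩
    have hw : (w : ℝ) = max ((c + pt x) / 2) (1 - b) := rfl
    have e1 := le_max_left ((c + pt x) / 2) (1 - b)
    have e2 := le_max_right ((c + pt x) / 2) (1 - b)
    have := hc w (by rw [hw]; linarith) (by rw [hw]; apply max_lt <;> linarith)
    have := (g w).2.2
    linarith
  obtain ⟨y, hy⟩ := exists_pt hpos hle
  exact ⟨y, map_lf_eq h1 hc hy⟩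

theorem left_finite {g : Equiv.Perm I01} (hg : PW g) :
    {x | Filter.map g (lf x) ≠ lf (g x)}.Finite := by
  refine ((Step.finite_jump hg).insert ⟨0, le_rfl, one_pos⟩).subset ?_
  intro x hx
  by_contra hcon
  rw [Set.mem_insert_iff, not_or] at hcon
  obtain ⟨hx0, hxF⟩ := hcon
  apply hx
  have hxp : 0 < (x : ℝ) := lt_of_le_of_ne x.2.1 (fun h' => hx0 (Subtype.ext h'.symm))
  have hxF := not_not.1 hxF
  obtain ⟨c, h0, h1, h⟩ := mem_lf.1 hxF
  have hp := pt_le_one x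
  have hc : ∀ z : I01, c < z → (z : ℝ) < pt x → (g z : ℝ) = z + ((g x : ℝ) - x) := by
    intro z hz1 hz2
    have : (g z : ℝ) - z = (g x : ℝ) - x := h z hz1 hz2
    linarith
  refine map_lf_eq h1 hc ?_
  rw [pt_of_pos hxp] at *
  let w : I01 := ⟨(c + x) / 2, by constructor <;> linarith⟩
  have hw : (w : ℝ) = (c + x) / 2 := rfl
  have := hc w (by rw [hw]; linarith) (by rw [hw]; linarith)
  have := (g w).2.1
  rw [pt_of_pos (by linarith)]
  ring

noncomputable def lmap (g : IETG) (x : I01) : I01 := (exists_lmap g.2.1 x).choose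

theorem lf_lmap (g : IETG) (x : I01) :
    lf (lmap g x) = Filter.map (g : Equiv.Perm I01) (lf x) :=
  (exists_lmap g.2.1 x).choose_spec.symm

/-- Left germs. -/
structure LI where
  /-- the base point -/
  base : I01

def toL (x : I01) : LI := ⟨x⟩

/-- the filter attached to a left germ -/
noncomputable def LI.fil (x : LI) : Filter I01 := lf x.base

theorem fil_injective : Function.Injective LI.fil := by
  rintro ⟨x⟩ ⟨y⟩ h
  exact congrArg toL (lf_injective h)

noncomputable instance : MulAction IETG LI where
  smul g x := toL (lmap g x.base)
  one_smul x := fil_injective (by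
    change lf (lmap 1 x.base) = lf x.base
    rw [lf_lmap]; exact Filter.map_id)
  mul_smul g h x := fil_injective (by
    change lf (lmap (g * h) x.base) = lf (lmap g (lmap h x.base))
    rw [lf_lmap, lf_lmap, lf_lmap, Filter.map_map]; rfl)

theorem fil_smul (g : IETG) (x : LI) : (g • x).fil = Filter.map (fun y => g • y) x.fil :=
  lf_lmap g x.base

instance fil_neBot (x : LI) : x.fil.NeBot := lf_neBot x.base


theorem smul_toL_finite (g : IETG) : {x : I01 | g • toL x ≠ toL (g • x)}.Finite := by
  refine (left_finite g.2.1).subset ?_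
  intro x hx h
  apply hx
  apply fil_injective
  rw [fil_smul]
  exact h

theorem toL_injective : Function.Injective toL := fun _ _ h => congrArg LI.base h

theorem toL_surjective : Function.Surjective toL := fun x => ⟨x.base, rfl⟩

theorem mem_fil_smul {g : IETG} {x : LI} {X : Set I01} :
    g • X ∈ (g • x).fil ↔ X ∈ x.fil := by
  rw [fil_smul, Filter.mem_map]
  have : (fun y : I01 => g • y) ⁻¹' (g • X) = X := by
    ext y; simp
  rw [this]

theorem Step.smul_comp {α : Type*} {f : I01 → α} (hf : Step f) (g : IETG) :
    Step (fun x => f (g • x)) := Step.comp hf g.2.1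

/-! ### Step sets -/

def StepS (X : Set I01) : Prop := Step (fun x => x ∈ X)

/-- left germs inside `X` -/
def LX (X : Set I01) : Set LI := {x | X ∈ x.fil}

theorem mem_LX {X : Set I01} {x : LI} : x ∈ LX X ↔ X ∈ x.fil := Iff.rfl

/-- boundary of `X` -/
def bd (X : Set I01) : Set I01 := {x | ¬ (x ∈ X ↔ toL x ∈ LX X)}

theorem StepS.compl {X : Set I01} (h : StepS X) : StepS Xᶜ := Step.map h (fun p => ¬ p)

theorem StepS.inter {X Y : Set I01} (h : StepS X) (h' : StepS Y) : StepS (X ∩ Y) :=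
  Step.map₂ h h' (fun p q => p ∧ q)

theorem StepS.smul {X : Set I01} (h : StepS X) (g : IETG) : StepS (g • X) := by
  have := Step.smul_comp h g⁻¹
  unfold StepS
  convert this using 2
  rw [Set.mem_smul_set_iff_inv_smul_mem]

theorem LX_mono {X Y : Set I01} (h : X ⊆ Y) : LX X ⊆ LX Y := fun x hx => by
  have hx' : X ∈ x.fil := hx
  show Y ∈ x.fil
  exact Filter.mem_of_superset hx' h

theorem LX_inter (X Y : Set I01) : LX (X ∩ Y) = LX X ∩ LX Y := by
  ext x; rw [Set.mem_inter_iff, mem_LX, mem_LX, mem_LX, Filter.inter_mem_iff]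

theorem LX_empty : LX ∅ = ∅ := by
  ext x
  simp only [Set.mem_empty_iff_false, iff_false]
  exact Filter.empty_notMem x.fil

theorem LX_nonempty {X : Set I01} {x : LI} (h : x ∈ LX X) : X.Nonempty :=
  (fil_neBot x).nonempty_of_mem h

theorem mem_LX_smul {X : Set I01} {x : LI} {g : IETG} : g • x ∈ LX (g • X) ↔ x ∈ LX X :=
  mem_fil_smul

theorem LX_smul (X : Set I01) (g : IETG) : LX (g • X) = g • LX X := by
  ext x
  have := mem_LX_smul (X := X) (x := g⁻¹ • x) (g := g)
  rw [smul_inv_smul] at this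
  rw [Set.mem_smul_set_iff_inv_smul_mem, this]

theorem StepS.mem_or {X : Set I01} (h : StepS X) (x : LI) : X ∈ x.fil ∨ Xᶜ ∈ x.fil := by
  obtain ⟨v, hv⟩ := Step.exists_left h x.base
  by_cases hvt : v
  · left
    filter_upwards [hv] with y hy
    rw [hy]; exact hvt
  · right
    filter_upwards [hv] with y hy
    intro hyX
    rw [hy] at hyX; exact hvt hyX

theorem LX_compl {X : Set I01} (h : StepS X) : LX Xᶜ = (LX X)ᶜ := by
  ext x
  constructor
  · intro h1 h2
    rw [mem_LX] at h1 h2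
    exact Set.not_nonempty_empty
      ((fil_neBot x).nonempty_of_mem (by simpa using Filter.inter_mem h1 h2))
  · intro h1
    exact (h.mem_or x).resolve_left h1

theorem bd_compl {X : Set I01} (h : StepS X) : bd Xᶜ = bd X := by
  ext x
  unfold bd
  rw [LX_compl h]
  simp only [Set.mem_compl_iff, Set.mem_ofPred_eq]
  tauto

theorem bd_finite {X : Set I01} (h : StepS X) : (bd X).Finite := by
  refine (Step.finite_jump h).subset ?_
  intro x hx hx'
  apply hx
  constructor
  · intro hxX
    show X ∈ lf x
    filter_upwards [hx'] with y hy
    rw [hy]; exact hxX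
  · intro hxX
    have hxX : X ∈ lf x := hxX
    obtain ⟨y, hy1, hy2⟩ := (lf_neBot x).nonempty_of_mem (Filter.inter_mem hxX hx')
    have : (y ∈ X) = (x ∈ X) := hy2
    rwa [← this]

def zeroI : I01 := ⟨0, le_rfl, one_pos⟩

theorem zeroI_le (x : I01) : zeroI ≤ x := x.2.1

theorem exists_greatest {F : Set I01} (hF : F.Finite) (h0 : zeroI ∈ F) (x : I01) :
    ∃ z ∈ F, z ≤ x ∧ ∀ z' ∈ F, z' ≤ x → z' ≤ z := by
  have hfin : (F ∩ Set.Iic x).Finite := hF.inter_of_left _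
  obtain ⟨z, hz, hmax⟩ := hfin.exists_maximal ⟨zeroI, h0, zeroI_le x⟩
  refine ⟨z, hz.1, hz.2, fun z' hz' hz'x => ?_⟩
  rcases le_total z' z with h | h
  · exact h
  · exact hmax ⟨hz', hz'x⟩ h

theorem Step.cover {α : Type*} {f : I01 → α} (hf : Step f) :
    ∃ F : Set I01, F.Finite ∧ zeroI ∈ F ∧ ∀ x, ∀ z ∈ F, z ≤ x → (∀ z' ∈ F, z' ≤ x → z' ≤ z) →
      f z = f x := by
  obtain ⟨F, hF, h⟩ := hf
  refine ⟨insert zeroI F, hF.insert _, Set.mem_insert _ _, fun x z hz hzx hmax => ?_⟩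
  rcases hzx.eq_or_lt with rfl | hlt
  · rfl
  · refine h z x hlt ?_
    rintro u hu ⟨h1, h2⟩
    exact absurd (hmax u (Or.inr hu) h2) (not_le.2 h1)

theorem Step.finite_range {α : Type*} {f : I01 → α} (hf : Step f) : (Set.range f).Finite := by
  obtain ⟨F, hF, h0, h⟩ := hf.cover
  refine (hF.image f).subset ?_
  rintro _ ⟨x, rfl⟩
  obtain ⟨z, hz, h1, h2⟩ := exists_greatest hF h0 x
  exact ⟨z, hz, h x z hz h1 h2⟩

theorem StepS.measurable {X : Set I01} (hX : StepS X) : MeasurableSet X := by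
  obtain ⟨F, hF, h0, h⟩ := hX.cover
  have : X = ⋃ z ∈ F ∩ X, (Set.Ici z ∩ ⋂ z' ∈ F, {x | z' ≤ x → z' ≤ z}) := by
    ext x
    simp only [Set.mem_iUnion, Set.mem_inter_iff, Set.mem_Ici, Set.mem_iInter, Set.mem_ofPred_eq]
    constructor
    · intro hx
      obtain ⟨z, hz, h1, h2⟩ := exists_greatest hF h0 x
      have := h x z hz h1 h2
      exact ⟨z, ⟨hz, by rwa [this]⟩, h1, h2⟩
    · rintro ⟨z, ⟨hz, hzX⟩, h1, h2⟩
      have := h x z hz h1 h2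
      rwa [← this]
  rw [this]
  refine (hF.inter_of_left X).measurableSet_biUnion (fun z _ => ?_)
  refine measurableSet_Ici.inter (hF.measurableSet_biInter (fun z' _ => ?_))
  by_cases hzz : z' ≤ z
  · simp [hzz]
  · have : {x : I01 | z' ≤ x → z' ≤ z} = Set.Iio z' := by
      ext x; simp [hzz]
    rw [this]; exact measurableSet_Iio

theorem Step.measurable {α : Type*} [MeasurableSpace α] {f : I01 → α}
    (hf : Step f) : Measurable f := by
  intro s _
  exact StepS.measurable (Step.map hf (fun a => a ∈ s))

/-- propagation: no boundary point in `(x,y]` -/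
theorem bd_aux {X : Set I01} (hX : StepS X) {x y : I01} (hxy : x < y)
    (hb : ∀ z ∈ bd X, ¬ (x < z ∧ z ≤ y)) (hx : x ∈ X) : y ∈ X := by
  by_contra hy
  obtain ⟨F, hF, h⟩ := hX
  have hfin : ({z | z ∈ insert y F ∧ x < z ∧ z ≤ y ∧ z ∉ X}).Finite :=
    (hF.insert y).subset (fun z hz => hz.1)
  obtain ⟨z0, ⟨hz0F, hz0x, hz0y, hz0X⟩, hmin⟩ :=
    hfin.exists_minimal ⟨y, Set.mem_insert _ _, hxy, le_rfl, hy⟩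
  have hnb : ¬ (z0 ∈ bd X) := fun hh => hb z0 hh ⟨hz0x, hz0y⟩
  have hnb' := not_not.1 hnb
  apply hz0X
  rw [hnb']
  have hz0p : 0 < (z0 : ℝ) := lt_of_le_of_lt x.2.1 hz0x
  show X ∈ lf z0
  refine mem_lf.2 ⟨x, x.2.1, by rw [pt_of_pos hz0p]; exact hz0x, fun w hw1 hw2 => ?_⟩
  rw [pt_of_pos hz0p] at hw2
  by_contra hwX
  have hF' : (insert x F ∩ Set.Iic w).Finite := (hF.insert x).inter_of_left _
  obtain ⟨u, ⟨hu1, hu2⟩, humax⟩ := hF'.exists_maximal ⟨x, Set.mem_insert _ _, le_of_lt hw1⟩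
  have hxu : x ≤ u := by
    rcases le_total x u with h' | h'
    · exact h'
    · exact humax ⟨Set.mem_insert _ _, le_of_lt hw1⟩ h'
  have huX : u ∉ X := by
    rcases (show u ≤ w from hu2).eq_or_lt with rfl | hlt
    · exact hwX
    · have := h u w hlt (by
        rintro v hv ⟨hv1, hv2⟩
        exact absurd (humax ⟨Or.inr hv, hv2⟩ hv1.le) (not_le.2 hv1))
      have this : (u ∈ X) = (w ∈ X) := this
      rwa [this]
  have hxu' : x < u := lt_of_le_of_ne hxu (by rintro rfl; exact huX hx)
  have huF : u ∈ F := hu1.resolve_left (by rintro rfl; exact lt_irrefl _ hxu')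
  have huz : u < z0 := lt_of_le_of_lt (show u ≤ w from hu2) hw2
  exact absurd (hmin ⟨Or.inr huF, hxu', (huz.le.trans hz0y), huX⟩ huz.le) (not_le.2 huz)

theorem bd_iff {X : Set I01} (hX : StepS X) {x y : I01} (hxy : x < y)
    (hb : ∀ z ∈ bd X, ¬ (x < z ∧ z ≤ y)) : x ∈ X ↔ y ∈ X := by
  refine ⟨bd_aux hX hxy hb, fun hy => ?_⟩
  by_contra hx
  exact bd_aux hX.compl hxy (by rwa [bd_compl hX]) hx hy

theorem finite_of_bd {F : Set I01} (hF : F.Finite) : {X | StepS X ∧ bd X ⊆ F}.Finite := by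
  have hF' : (insert zeroI F).Finite := hF.insert _
  refine Set.Finite.of_injOn (f := fun X => X ∩ insert zeroI F) (t := {Y | Y ⊆ insert zeroI F})
    (fun X _ => Set.inter_subset_right) ?_ hF'.finite_subsets
  have key : ∀ X, StepS X → bd X ⊆ F → ∀ x z, z ∈ insert zeroI F → z ≤ x →
      (∀ z' ∈ insert zeroI F, z' ≤ x → z' ≤ z) → (z ∈ X ↔ x ∈ X) := by
    intro X hX hb x z hz hzx hmax
    rcases hzx.eq_or_lt with rfl | hlt
    · rfl
    · refine bd_iff hX hlt ?_
      rintro u hu ⟨h1, h2⟩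
      exact absurd (hmax u (Or.inr (hb hu)) h2) (not_le.2 h1)
  rintro X ⟨hX, hXb⟩ Y ⟨hY, hYb⟩ hXY
  have hXY' : X ∩ insert zeroI F = Y ∩ insert zeroI F := hXY
  ext x
  obtain ⟨z, hz, h1, h2⟩ := exists_greatest hF' (Set.mem_insert _ _) x
  rw [← key X hX hXb x z hz h1 h2, ← key Y hY hYb x z hz h1 h2]
  constructor
  · intro h
    have : z ∈ X ∩ insert zeroI F := ⟨h, hz⟩
    rw [hXY'] at this; exact this.1
  · intro h
    have : z ∈ Y ∩ insert zeroI F := ⟨h, hz⟩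
    rw [← hXY'] at this; exact this.1

theorem eq_univ_of_bd_empty {X : Set I01} (hX : StepS X) (hb : bd X = ∅) (hne : X.Nonempty) :
    X = Set.univ := by
  have h : ∀ x, zeroI ∈ X ↔ x ∈ X := by
    intro x
    rcases (zeroI_le x).eq_or_lt with h' | h'
    · rw [h']
    · exact bd_iff hX h' (by rw [hb]; simp)
  obtain ⟨x, hx⟩ := hne
  ext y
  simp only [Set.mem_univ, iff_true]
  exact (h y).1 ((h x).2 hx)

/-! ### Fixed sets -/

def fixS (g : IETG) : Set I01 := {x | g • x = x}

theorem smul_val (g : IETG) (x : I01) : g • x = (g : Equiv.Perm I01) x := rfl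

theorem fixS_step (g : IETG) : StepS (fixS g) := by
  have := Step.map g.2.1 (fun r => r = 0)
  unfold StepS fixS
  convert this using 2 with x
  rw [Set.mem_ofPred_eq, smul_val, sub_eq_zero, Subtype.ext_iff]

theorem smul_congr_LX {g h : IETG} {C : Set I01} (H : ∀ x ∈ C, g • x = h • x) {x : LI}
    (hx : x ∈ LX C) : g • x = h • x := by
  apply fil_injective
  rw [fil_smul, fil_smul]
  apply Filter.map_congr
  filter_upwards [hx] with y hy
  exact H y hy

theorem mem_LX_fixS {g : IETG} {x : LI} : x ∈ LX (fixS g) ↔ g • x = x := by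
  constructor
  · intro h
    have := smul_congr_LX (g := g) (h := 1) (C := fixS g) (fun y hy => by
      rw [one_smul]; exact hy) h
    rwa [one_smul] at this
  · intro h
    obtain ⟨b, hb⟩ := Step.exists_left g.2.1 x.base
    obtain ⟨c, h0, h1, hc⟩ := mem_lf.1 hb
    -- the displacement must vanish
    have hfix : Filter.map (fun y : I01 => g • y) x.fil = x.fil := by
      rw [← fil_smul, h]
    by_cases hb0 : b = 0
    · show fixS g ∈ lf x.base
      filter_upwards [hb] with y hy
      apply Subtype.ext
      rw [smul_val]
      have : ((g : Equiv.Perm I01) y : ℝ) - y = b := hy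
      linarith
    · exfalso
      -- points near `pt x` on the left are mapped away
      have hS : {y : I01 | (y : ℝ) < pt x.base ∧ pt x.base - |b| / 2 < y} ∈ x.fil := by
        refine mem_lf.2 ⟨max 0 (pt x.base - |b| / 2), le_max_left _ _,
          max_lt (pt_pos _) ?_, fun y h1 h2 => ⟨h2, (le_max_right _ _).trans_lt h1⟩⟩
        have := abs_pos.2 hb0
        linarith
      have hS' := hS
      rw [← hfix, Filter.mem_map] at hS'
      obtain ⟨y, ⟨⟨hy1, hy2⟩, hy3, hy4⟩, hy5⟩ :=
        (fil_neBot x).nonempty_of_mem (Filter.inter_mem (Filter.inter_mem hS hS') hb)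
      have hy3 : ((g : Equiv.Perm I01) y : ℝ) < pt x.base := hy3
      have hy4 : pt x.base - |b| / 2 < ((g : Equiv.Perm I01) y : ℝ) := hy4
      have : ((g : Equiv.Perm I01) y : ℝ) - y = b := hy5
      rcases abs_cases b with ⟨e, _⟩ | ⟨e, _⟩ <;> rw [e] at hy2 hy4 <;> linarith

/-! ### Measure -/

/-- Lebesgue measure on `[0,1)` -/
noncomputable def mI : MeasureTheory.Measure I01 :=
  MeasureTheory.Measure.comap Subtype.val MeasureTheory.volume

open MeasureTheory in
theorem measure_smul_aux (g : IETG) (S : Set I01) (hS : MeasurableSet S) :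
    mI ((fun x : I01 => g • x) ⁻¹' S) = mI S := by
  have hval : MeasurableEmbedding (Subtype.val : I01 → ℝ) :=
    MeasurableEmbedding.subtype_coe measurableSet_Ico
  let d : I01 → ℝ := fun x => ((g : Equiv.Perm I01) x : ℝ) - x
  have hd : Step d := g.2.1
  let d' : I01 → ℝ := fun y => (y : ℝ) - ((g⁻¹ : IETG) • y : I01)
  have hd' : Step d' := by
    have := Step.map (g⁻¹).2.1 (fun r => -r)
    convert this using 2 with y
    show (y : ℝ) - _ = _
    rw [neg_sub]; rfl
  let R := hd.finite_range.toFinset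
  have hmeas : Measurable (fun x : I01 => g • x) := by
    have h1 : Measurable (fun x : I01 => d x + x) := hd.measurable.add measurable_subtype_coe
    rw [← hval.measurable_comp_iff]
    convert h1 using 2 with x
    simp [d, smul_val]
  have hdd : ∀ x, d' (g • x) = d x := by
    intro x
    show ((g • x : I01) : ℝ) - ((g⁻¹ • (g • x) : I01)) = _
    rw [inv_smul_smul]; rfl
  have hcov : ∀ (e : I01 → ℝ), Measurable e → (∀ x, e x ∈ R) → ∀ A : Set I01, MeasurableSet A →
      mI A = ∑ c ∈ R, mI (A ∩ e ⁻¹' {c}) := by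
    intro e he heR A hA
    rw [← measure_biUnion_finset]
    · congr 1
      ext x
      simp only [Set.mem_iUnion, Set.mem_inter_iff, Set.mem_preimage, Set.mem_singleton_iff,
        exists_prop]
      exact ⟨fun h => ⟨e x, heR x, h, rfl⟩, fun ⟨c, _, h, _⟩ => h⟩
    · intro c _ c' _ hcc'
      rw [Function.onFun, Set.disjoint_left]
      rintro x ⟨_, h1⟩ ⟨_, h2⟩
      exact hcc' (h1.symm.trans h2)
    · intro c _
      exact hA.inter (he (measurableSet_singleton c))
  have hR : ∀ x, d x ∈ R := fun x => by simp [R]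
  have hR' : ∀ y, d' y ∈ R := fun y => by
    have := hdd (g⁻¹ • y)
    rw [smul_inv_smul] at this
    rw [this]; exact hR _
  rw [hcov d hd.measurable hR _ (hmeas hS), hcov d' hd'.measurable hR' S hS]
  refine Finset.sum_congr rfl (fun c _ => ?_)
  have hv : ∀ A : Set I01, mI A = volume (Subtype.val '' A) := fun A =>
    hval.comap_apply volume A
  rw [hv, hv]
  have himg : (Subtype.val '' (S ∩ d' ⁻¹' {c}) : Set ℝ) =
      (fun r : ℝ => r + c) '' (Subtype.val '' ((fun x : I01 => g • x) ⁻¹' S ∩ d ⁻¹' {c})) := by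
    ext r
    constructor
    · rintro ⟨y, ⟨hy1, hy2⟩, rfl⟩
      refine ⟨(g⁻¹ • y : I01), ⟨g⁻¹ • y, ⟨?_, ?_⟩, rfl⟩, ?_⟩
      · simpa using hy1
      · have := hdd (g⁻¹ • y)
        rw [smul_inv_smul] at this
        rw [Set.mem_preimage, ← this]; exact hy2
      · have : (y : ℝ) - ((g⁻¹ : IETG) • y : I01) = c := hy2
        simp only
        linarith
    · rintro ⟨_, ⟨x, ⟨hx1, hx2⟩, rfl⟩, rfl⟩
      refine ⟨g • x, ⟨hx1, ?_⟩, ?_⟩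
      · rw [Set.mem_preimage, hdd]; exact hx2
      · have : ((g : Equiv.Perm I01) x : ℝ) - x = c := hx2
        simp only [smul_val]
        linarith
  rw [himg]
  rw [Set.image_add_right, measure_preimage_add_right]

open MeasureTheory in
theorem measurable_smul_IET (g : IETG) : Measurable (fun x : I01 => g • x) := by
  have hval : MeasurableEmbedding (Subtype.val : I01 → ℝ) :=
    MeasurableEmbedding.subtype_coe measurableSet_Ico
  have hd : Step (fun x : I01 => ((g : Equiv.Perm I01) x : ℝ) - x) := g.2.1
  have h1 : Measurable (fun x : I01 => (((g : Equiv.Perm I01) x : ℝ) - x) + x) :=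
    hd.measurable.add measurable_subtype_coe
  rw [← hval.measurable_comp_iff]
  convert h1 using 2 with x
  simp [smul_val]

open MeasureTheory in
theorem measurePreserving_smul_IET (g : IETG) :
    MeasurePreserving (fun x : I01 => g • x) mI mI :=
  ⟨measurable_smul_IET g, by
    ext S hS
    rw [Measure.map_apply (measurable_smul_IET g) hS, measure_smul_aux g S hS]⟩

open MeasureTheory in
theorem mI_smul {X : Set I01} (hX : StepS X) (g : IETG) : mI (g • X) = mI X := by
  rw [← measure_smul_aux g _ (hX.smul g).measurable]
  congr 1
  ext y; simp

open MeasureTheory in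
theorem mI_univ_I01 : mI (Set.univ : Set I01) = 1 := by
  have hval : MeasurableEmbedding (Subtype.val : I01 → ℝ) :=
    MeasurableEmbedding.subtype_coe measurableSet_Ico
  rw [mI, hval.comap_apply, Set.image_univ, Subtype.range_coe]
  simp

open MeasureTheory in
instance : IsFiniteMeasure mI := ⟨by rw [mI_univ_I01]; simp⟩

open MeasureTheory in
theorem mI_Ico_I01 (s t : I01) : mI (Set.Ico s t) = ENNReal.ofReal ((t : ℝ) - s) := by
  have hval : MeasurableEmbedding (Subtype.val : I01 → ℝ) :=
    MeasurableEmbedding.subtype_coe measurableSet_Ico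
  have hv : ∀ A : Set I01, mI A = volume (Subtype.val '' A) := fun A =>
    hval.comap_apply volume A
  rw [hv, ← Real.volume_Ico]
  congr 1
  ext r
  constructor
  · rintro ⟨x, ⟨h1, h2⟩, rfl⟩
    exact ⟨h1, h2⟩
  · rintro ⟨h1, h2⟩
    exact ⟨⟨r, s.2.1.trans h1, h2.trans t.2.2⟩, ⟨h1, h2⟩, rfl⟩

/-- a step function is constant slightly to the right of a point -/
theorem Step.right {α : Type*} {f : I01 → α} (hf : Step f) (x : I01) :
    ∃ y : I01, x < y ∧ ∀ z, x ≤ z → z < y → f z = f x := by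
  obtain ⟨F, hF, h⟩ := hf
  have : ∃ y : I01, x < y ∧ ∀ u ∈ F, x < u → y ≤ u := by
    clear h
    induction F, hF using Set.Finite.induction_on with
    | empty =>
      have h0 := x.2.1
      have h1 := x.2.2
      exact ⟨⟨(x + 1) / 2, by constructor <;> linarith⟩,
        show (x : ℝ) < (x + 1) / 2 by linarith, by simp⟩
    | @insert a s ha hs ih =>
      obtain ⟨y, hy, h1⟩ := ih
      by_cases hxa : x < a
      · refine ⟨min y a, lt_min hy hxa, ?_⟩
        rintro u (rfl | hu) hxu
        · exact min_le_right _ _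
        · exact (min_le_left _ _).trans (h1 u hu hxu)
      · refine ⟨y, hy, ?_⟩
        rintro u (rfl | hu) hxu
        · exact absurd hxu hxa
        · exact h1 u hu hxu
  obtain ⟨y, hy, h1⟩ := this
  refine ⟨y, hy, fun z hz1 hz2 => ?_⟩
  rcases hz1.eq_or_lt with rfl | hlt
  · rfl
  · refine (h x z hlt ?_).symm
    rintro u hu ⟨hu1, hu2⟩
    exact absurd (h1 u hu hu1) (not_le.2 (hu2.trans_lt hz2))

open MeasureTheory in
theorem mI_pos_of_step {X : Set I01} (hX : StepS X) (hne : X.Nonempty) : 0 < mI X := by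
  obtain ⟨x, hx⟩ := hne
  obtain ⟨y, hy, h⟩ := Step.right hX x
  have hsub : Set.Ico x y ⊆ X := by
    rintro z ⟨h1, h2⟩
    have := h z h1 h2
    rwa [this]
  refine lt_of_lt_of_le ?_ (measure_mono hsub)
  rw [mI_Ico_I01, ENNReal.ofReal_pos]
  have : (x : ℝ) < y := hy
  linarith

/-! ### Commensurated sets -/
section Comm
variable {Γ : Type*} [Group Γ] {E : Type*} [MulAction Γ E]

/-- aperiodic point -/
def Ap (a : Γ) (e : E) : Prop := ∀ n : ℕ, 0 < n → a ^ n • e ≠ e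

/-- the orbit eventually lies in `D` -/
def End (D : Set E) (a : Γ) (e : E) : Prop := ∀ᶠ n : ℕ in atTop, a ^ n • e ∈ D

theorem Ap.zpow_inj {a : Γ} {e : E} (h : Ap a e) : Function.Injective (fun n : ℤ => a ^ n • e) := by
  have key : ∀ m n : ℤ, m < n → a ^ m • e ≠ a ^ n • e := by
    intro m n hmn heq
    have h1 : a ^ (n - m) • e = e := by
      rw [zpow_sub, mul_smul, ← zpow_neg]
      have : a ^ n • a ^ (-m) • e = a ^ (-m) • a ^ n • e := by
        rw [← mul_smul, ← mul_smul, ← zpow_add, ← zpow_add, add_comm]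
      rw [this, ← heq, ← mul_smul, ← zpow_add]; simp
    obtain ⟨k, hk⟩ := Int.eq_ofNat_of_zero_le (show 0 ≤ n - m by omega)
    rw [hk, zpow_natCast] at h1
    exact h k (by omega) h1
  intro m n hmn
  rcases lt_trichotomy m n with h1 | h1 | h1
  · exact absurd hmn (key _ _ h1)
  · exact h1
  · exact absurd hmn.symm (key _ _ h1)

theorem Ap.pow_inj {a : Γ} {e : E} (h : Ap a e) : Function.Injective (fun n : ℕ => a ^ n • e) := by
  intro m n hmn
  have := h.zpow_inj (a₁ := m) (a₂ := n) (by simpa using hmn)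
  exact_mod_cast this

theorem Ap.zpow_ne {a : Γ} {e : E} (h : Ap a e) {n : ℤ} (hn : n ≠ 0) : a ^ n • e ≠ e := by
  intro h1
  apply hn
  apply h.zpow_inj
  simpa using h1

theorem Ap.of_zpow {a : Γ} {e : E} (h : ∀ n : ℤ, n ≠ 0 → a ^ n • e ≠ e) : Ap a e := by
  intro n hn h1
  exact h n (by exact_mod_cast hn.ne') (by simpa using h1)

theorem Ap.inv {a : Γ} {e : E} (h : Ap a e) : Ap a⁻¹ e :=
  Ap.of_zpow (fun n hn => by rw [inv_zpow']; exact h.zpow_ne (by simpa using hn))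

theorem Ap.pow {a : Γ} {e : E} (h : Ap a e) {k : ℕ} (hk : 0 < k) : Ap (a ^ k) e := by
  intro n hn; rw [← pow_mul]; exact h _ (Nat.mul_pos hk hn)

theorem Ap.of_pow {a : Γ} {e : E} {k : ℕ} (hk : 0 < k) (h : Ap (a ^ k) e) : Ap a e := by
  intro n hn h1
  apply h n hn
  rw [← pow_mul, mul_comm, pow_mul]
  clear h
  induction k with
  | zero => simp
  | succ m ih =>
    rcases Nat.eq_zero_or_pos m with rfl | hm
    · simpa using h1
    · rw [pow_succ, mul_smul, h1, ih hm]

theorem conj_pow_smul (g a : Γ) (n : ℕ) (e : E) : (g * a * g⁻¹) ^ n • g • e = g • a ^ n • e := by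
  rw [conj_pow, ← mul_smul, ← mul_smul]; simp

theorem Ap.conj {a : Γ} {e : E} (h : Ap a e) (g : Γ) : Ap (g * a * g⁻¹) (g • e) := by
  intro n hn h1
  rw [conj_pow_smul] at h1
  exact h n hn (smul_left_cancel g h1)

theorem Ap.self_zpow {a : Γ} {e : E} (h : Ap a e) (n : ℤ) : Ap a (a ^ n • e) := by
  have := h.conj (a ^ n)
  rwa [show a ^ n * a * (a ^ n)⁻¹ = a by rw [← zpow_neg, ← zpow_add_one, ← zpow_add]; simp] at this

theorem Ap.eventually {a : Γ} {e : E} (h : Ap a e) {S : Set E} (hS : S.Finite) :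
    ∀ᶠ n : ℕ in atTop, a ^ n • e ∉ S := by
  have : {n : ℕ | a ^ n • e ∈ S}.Finite := hS.preimage (f := fun n : ℕ => a ^ n • e) h.pow_inj.injOn
  rw [← Nat.cofinite_eq_atTop]
  have h2 := this.compl_mem_cofinite
  filter_upwards [h2] with n hn
  exact hn

/-- commensurated -/
def CommS (Γ : Type*) [Group Γ] {E : Type*} [MulAction Γ E] (D : Set E) : Prop :=
  ∀ g : Γ, {e | e ∈ D ∧ g • e ∉ D}.Finite

variable {D : Set E}

theorem End.dich (hD : CommS Γ D) {a : Γ} {e : E} (h : Ap a e) :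
    End D a e ∨ ∀ᶠ n : ℕ in atTop, a ^ n • e ∉ D := by
  have h1 := h.eventually (hD a)
  obtain ⟨N, hN⟩ := eventually_atTop.1 h1
  by_cases hex : ∃ n ≥ N, a ^ n • e ∈ D
  · left
    obtain ⟨n, hn, hnD⟩ := hex
    refine eventually_atTop.2 ⟨n, fun m hm => ?_⟩
    induction m, hm using Nat.le_induction with
    | base => exact hnD
    | succ m hm ih =>
      by_contra hcon
      apply hN m (by omega)
      refine ⟨ih, ?_⟩
      rwa [← mul_smul, ← pow_succ']
  · right
    push Not at hex
    exact eventually_atTop.2 ⟨N, hex⟩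

theorem End.pow_iff (hD : CommS Γ D) {a : Γ} {e : E} (h : Ap a e) {k : ℕ} (hk : 0 < k) :
    End D (a ^ k) e ↔ End D a e := by
  have ht : Tendsto (fun n : ℕ => k * n) atTop atTop :=
    tendsto_id.const_mul_atTop' hk
  constructor
  · intro h1
    rcases End.dich hD h with h2 | h2
    · exact h2
    · exfalso
      have h3 := ht.eventually h2
      obtain ⟨n, hn1, hn2⟩ := (h1.and h3).exists
      rw [pow_mul] at hn2
      exact hn2 hn1
  · intro h1
    have h3 := ht.eventually h1
    filter_upwards [h3] with n hn
    rwa [pow_mul] at hn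

theorem End.conj (hD : CommS Γ D) {a : Γ} {e : E} (h : Ap a e) (g : Γ) (h1 : End D a e) :
    End D (g * a * g⁻¹) (g • e) := by
  filter_upwards [h1, h.eventually (hD g)] with n hn1 hn2
  rw [conj_pow_smul]
  by_contra hcon
  exact hn2 ⟨hn1, hcon⟩

theorem End.conj_iff (hD : CommS Γ D) {a : Γ} {e : E} (h : Ap a e) (g : Γ) :
    End D (g * a * g⁻¹) (g • e) ↔ End D a e := by
  refine ⟨fun h1 => ?_, End.conj hD h g⟩
  have := End.conj hD (h.conj g) g⁻¹ h1
  simpa [mul_assoc] using this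

theorem End.comm_iff (hD : CommS Γ D) {a b : Γ} {e : E} (h : Ap a e) (hab : Commute a b) :
    End D a (b • e) ↔ End D a e := by
  have := End.conj_iff hD h b
  rwa [← hab.eq, mul_inv_cancel_right] at this

theorem End.zpow_iff (hD : CommS Γ D) {a : Γ} {e : E} (h : Ap a e) (n : ℤ) :
    End D a (a ^ n • e) ↔ End D a e :=
  End.comm_iff hD h ((Commute.refl a).zpow_right n)

theorem End.zpow_iff' (hD : CommS Γ D) {a : Γ} {e : E} (h : Ap a e) (n : ℤ) :
    End D a⁻¹ (a ^ n • e) ↔ End D a⁻¹ e :=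
  End.comm_iff hD h.inv ((Commute.refl a).zpow_right n).inv_left

/-- orbits coming from outside and ending in `D` pass through a transition point -/
theorem exists_enter {a : Γ} {e : E} {m n : ℤ} (hmn : m ≤ n) (hm : a ^ m • e ∉ D)
    (hn : a ^ n • e ∈ D) : ∃ k : ℤ, a ^ k • e ∈ D ∧ a⁻¹ • a ^ k • e ∉ D := by
  induction n, hmn using Int.leInduction with
  | base => exact absurd hn hm
  | succ n hmn ih =>
    by_cases h : a ^ n • e ∈ D
    · exact ih h
    · refine ⟨n + 1, hn, ?_⟩
      rwa [← mul_smul, ← zpow_neg_one, ← zpow_add, neg_add_cancel_comm_assoc]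

theorem exists_exit {a : Γ} {e : E} {m n : ℤ} (hmn : m ≤ n) (hm : a ^ m • e ∈ D)
    (hn : a ^ n • e ∉ D) : ∃ k : ℤ, a ^ k • e ∈ D ∧ a • a ^ k • e ∉ D := by
  induction n, hmn using Int.leInduction with
  | base => exact absurd hm hn
  | succ n hmn ih =>
    by_cases h : a ^ n • e ∈ D
    · refine ⟨n, h, ?_⟩
      rwa [← mul_smul, ← zpow_one_add, add_comm]
    · exact ih h

theorem End.enter {a : Γ} {e : E} (h1 : End D a e) (h2 : ¬ End D a⁻¹ e) :
    ∃ k : ℤ, a ^ k • e ∈ D ∧ a⁻¹ • a ^ k • e ∉ D := by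
  obtain ⟨N, hN⟩ := eventually_atTop.1 h1
  have h2' : ∃ᶠ n : ℕ in atTop, a⁻¹ ^ n • e ∉ D := not_eventually.1 h2
  obtain ⟨n, hn⟩ := h2'.exists
  refine exists_enter (m := -n) (n := N) (by omega) ?_ ?_
  · simpa using hn
  · simpa using hN N le_rfl

theorem finite_trans (hD : CommS Γ D) (a : Γ) :
    {e | e ∈ D ∧ Ap a e ∧ ¬ End D a e ∧ ¬ End D a⁻¹ e}.Finite := by
  have hfin : (⋃ t ∈ {t | (t ∈ D ∧ a • t ∉ D) ∧ Ap a t ∧ ¬ End D a t ∧ ¬ End D a⁻¹ t},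
      (fun n : ℤ => a ^ n • t) '' {n : ℤ | a ^ n • t ∈ D}).Finite := by
    refine Set.Finite.biUnion ((hD a).subset (fun t ht => ht.1)) ?_
    rintro t ⟨-, ht, h1, h2⟩
    apply Set.Finite.image
    have h1' := (End.dich hD ht).resolve_left h1
    have h2' := (End.dich hD ht.inv).resolve_left h2
    obtain ⟨N, hN⟩ := eventually_atTop.1 h1'
    obtain ⟨M, hM⟩ := eventually_atTop.1 h2'
    refine (Set.finite_Icc (-(M : ℤ)) N).subset ?_
    intro n hn
    have hn : a ^ n • t ∈ D := hn
    constructor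
    · by_contra hcon
      push Not at hcon
      obtain ⟨k, hk⟩ := Int.eq_ofNat_of_zero_le (show 0 ≤ -n by omega)
      apply hM k (by omega)
      rwa [← zpow_natCast, inv_zpow', ← hk, neg_neg]
    · by_contra hcon
      push Not at hcon
      obtain ⟨k, hk⟩ := Int.eq_ofNat_of_zero_le (show 0 ≤ n by omega)
      apply hN k (by omega)
      rwa [← zpow_natCast, ← hk]
  refine hfin.subset ?_
  rintro e ⟨heD, hap, h1, h2⟩
  have h1' : ∃ᶠ n : ℕ in atTop, a ^ n • e ∉ D := not_eventually.1 h1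
  obtain ⟨n, hn⟩ := h1'.exists
  obtain ⟨k, hk1, hk2⟩ := exists_exit (D := D) (a := a) (e := e) (m := 0) (n := n) (by omega)
    (by simpa using heD) (by simpa using hn)
  simp only [Set.mem_iUnion]
  refine ⟨a ^ k • e, ⟨⟨hk1, hk2⟩, hap.self_zpow k, ?_, ?_⟩, -k, ?_, ?_⟩
  · rwa [End.zpow_iff hD hap]
  · rwa [End.zpow_iff' hD hap]
  · show a ^ (-k) • a ^ k • e ∈ D
    rwa [← mul_smul, ← zpow_add, neg_add_cancel, zpow_zero, one_smul]
  · show a ^ (-k) • a ^ k • e = e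
    rw [← mul_smul, ← zpow_add, neg_add_cancel, zpow_zero, one_smul]

theorem per_orbit_finite {a : Γ} {y : E} {k : ℕ} (hk : 0 < k) (h : a ^ k • y = y) :
    {z | ∃ n : ℤ, z = a ^ n • y}.Finite := by
  refine ((Set.finite_Ico (0 : ℤ) k).image (fun n : ℤ => a ^ n • y)).subset ?_
  rintro z ⟨n, rfl⟩
  have hk' : (k : ℤ) ≠ 0 := by omega
  refine ⟨n % k, ⟨Int.emod_nonneg _ hk', Int.emod_lt_of_pos _ (by omega)⟩, ?_⟩
  have : a ^ n = a ^ (n % k) * (a ^ k) ^ (n / k) := by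
    rw [← zpow_natCast, ← zpow_mul, ← zpow_add]
    congr 1
    exact (Int.emod_add_mul_ediv n k).symm
  show a ^ (n % k) • y = a ^ n • y
  rw [this, mul_smul]
  congr 1
  have hmem : a ^ k ∈ MulAction.stabilizer Γ y := h
  exact (Subgroup.zpow_mem _ hmem (n / k)).symm

/-! ### The transfer character -/

/-- relative cardinality -/
noncomputable def dd (P Q : Set E) : ℤ := ((P \ Q).ncard : ℤ) - (Q \ P).ncard

theorem dd_eq {P Q U : Set E} (hU : U.Finite) (h1 : P \ Q ⊆ U) (h2 : Q \ P ⊆ U) :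
    dd P Q = ((P ∩ U).ncard : ℤ) - (Q ∩ U).ncard := by
  have key : ∀ P Q : Set E, P \ Q ⊆ U → (P ∩ U).ncard = (P \ Q).ncard + (P ∩ Q ∩ U).ncard := by
    intro P Q h
    rw [← Set.ncard_union_eq ?_ (hU.subset h) (hU.subset Set.inter_subset_right)]
    · congr 1
      ext x
      constructor
      · rintro ⟨h3, h4⟩
        by_cases hQ : x ∈ Q
        · exact Or.inr ⟨⟨h3, hQ⟩, h4⟩
        · exact Or.inl ⟨h3, hQ⟩
      · rintro (h3 | h3)
        · exact ⟨h3.1, h h3⟩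
        · exact ⟨h3.1.1, h3.2⟩
    · rw [Set.disjoint_left]
      rintro x h3 h4
      exact h3.2 h4.1.2
  have e1 := key P Q h1
  have e2 := key Q P h2
  rw [Set.inter_comm Q P] at e2
  unfold dd
  omega

theorem dd_add {P Q R : Set E} (h1 : (P \ Q).Finite) (h2 : (Q \ P).Finite) (h3 : (Q \ R).Finite)
    (h4 : (R \ Q).Finite) : dd P R = dd P Q + dd Q R := by
  have hU := ((h1.union h2).union h3).union h4
  rw [dd_eq hU (P := P) (Q := Q), dd_eq hU (P := Q) (Q := R), dd_eq hU (P := P) (Q := R)]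
  · ring
  · rintro x ⟨hx1, hx2⟩
    by_cases hQ : x ∈ Q
    · exact Or.inl (Or.inr ⟨hQ, hx2⟩)
    · exact Or.inl (Or.inl (Or.inl ⟨hx1, hQ⟩))
  · rintro x ⟨hx1, hx2⟩
    by_cases hQ : x ∈ Q
    · exact Or.inl (Or.inl (Or.inr ⟨hQ, hx2⟩))
    · exact Or.inr ⟨hx1, hQ⟩
  · exact fun x hx => Or.inl (Or.inr hx)
  · exact fun x hx => Or.inr hx
  · exact fun x hx => Or.inl (Or.inl (Or.inl hx))
  · exact fun x hx => Or.inl (Or.inl (Or.inr hx))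

theorem dd_smul (g : Γ) (P Q : Set E) : dd (g • P) (g • Q) = dd P Q := by
  unfold dd
  rw [← Set.smul_set_sdiff, ← Set.smul_set_sdiff, Set.ncard_smul_set, Set.ncard_smul_set]

theorem tau_lemma {K : Subgroup Γ} {P : Set E} (hK : ∀ g ∈ K, (g • P \ P).Finite) {a : Γ}
    (ha : a ∈ K) (haP : a • P ⊂ P) {g h : Γ} (hg : g ∈ K) (hh : h ∈ K) {p : ℕ} {j : ℤ}
    (hw : (g * h * g⁻¹ * h⁻¹) ^ p • P = a ^ j • P) : j = 0 := by
  have hK' : ∀ g ∈ K, (P \ g • P).Finite := by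
    intro g hg
    have := (hK g⁻¹ (K.inv_mem hg)).smul_set (a := g)
    rwa [Set.smul_set_sdiff, smul_inv_smul] at this
  let τ : K →* Multiplicative ℤ :=
    { toFun := fun g => Multiplicative.ofAdd (dd ((g : Γ) • P) P)
      map_one' := by
        show Multiplicative.ofAdd (dd ((1 : Γ) • P) P) = 1
        rw [one_smul]; simp [dd]
      map_mul' := by
        intro x y
        show Multiplicative.ofAdd (dd (((x : Γ) * y) • P) P) = _
        rw [← ofAdd_add]
        congr 1
        rw [dd_add (Q := (x : Γ) • P), mul_smul, dd_smul, add_comm]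
        · rw [mul_smul, ← Set.smul_set_sdiff]; exact (hK y y.2).smul_set
        · rw [mul_smul, ← Set.smul_set_sdiff]; exact (hK' y y.2).smul_set
        · exact hK x x.2
        · exact hK' x x.2 }
  have e : τ ((⟨g, hg⟩ * ⟨h, hh⟩ * ⟨g, hg⟩⁻¹ * ⟨h, hh⟩⁻¹) ^ p) = τ (⟨a, ha⟩ ^ j) := by
    show Multiplicative.ofAdd (dd ((g * h * g⁻¹ * h⁻¹) ^ p • P) P) =
      Multiplicative.ofAdd (dd ((⟨a, ha⟩ ^ j : K) • P) P)
    rw [hw]; rfl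
  have e1 : τ ((⟨g, hg⟩ * ⟨h, hh⟩ * ⟨g, hg⟩⁻¹ * ⟨h, hh⟩⁻¹) ^ p) = 1 := by
    simp only [map_pow, map_mul, map_inv]
    rw [mul_comm (τ _) (τ _), mul_inv_cancel_right, mul_inv_cancel, one_pow]
  rw [e1, map_zpow] at e
  have e2 : j * (τ ⟨a, ha⟩).toAdd = 0 := by
    have := congrArg Multiplicative.toAdd e
    simpa [toAdd_zpow] using this.symm
  rcases mul_eq_zero.1 e2 with h1 | h1
  · exact h1
  · exfalso
    have h2 : dd (a • P) P = 0 := h1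
    unfold dd at h2
    rw [Set.sdiff_eq_empty.2 haP.1] at h2
    have h3 := (Set.ncard_eq_zero (hK' a ha)).1 (by simpa using h2)
    exact haP.2 (Set.sdiff_eq_empty.1 h3)

end Comm

/-! ### Aperiodic parts and atoms -/

/-- the diagonal -/
def Dg : Set (LI × I01) := {e | e.1 = toL e.2}

theorem mem_Dg {e : LI × I01} : e ∈ Dg ↔ e.1 = toL e.2 := Iff.rfl

theorem Dg_comm : CommS IETG Dg := by
  intro g
  refine ((smul_toL_finite g).image (fun x => (toL x, x))).subset ?_
  rintro ⟨l, x⟩ ⟨h1, h2⟩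
  have h1 : l = toL x := h1
  subst h1
  exact ⟨x, h2, rfl⟩

theorem Ap.of_snd {a : IETG} {e : LI × I01} (h : Ap a e.2) : Ap a e :=
  fun n hn h1 => h n hn (congrArg Prod.snd h1)

theorem Ap.of_fst {a : IETG} {e : LI × I01} (h : Ap a e.1) : Ap a e :=
  fun n hn h1 => h n hn (congrArg Prod.fst h1)

theorem pow_fix {Γ : Type*} [Group Γ] {E : Type*} [MulAction Γ E] {a : Γ} {y : E} {k : ℕ}
    (h : a ^ k • y = y) (l : ℕ) : a ^ (k * l) • y = y := by
  have hmem : a ^ k ∈ MulAction.stabilizer Γ y := h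
  rw [pow_mul]
  exact Subgroup.pow_mem _ hmem l

theorem pow_fix' {Γ : Type*} [Group Γ] {E : Type*} [MulAction Γ E] {a : Γ} {y : E} {k : ℕ}
    (h : a ^ k • y = y) (l : ℕ) : a ^ (l * k) • y = y := by
  rw [mul_comm]; exact pow_fix h l

theorem fix_bd_finite (T : IETG) : ∃ F : Set I01, F.Finite ∧ ∀ k : ℕ, 0 < k →
    bd (fixS (T ^ k)) ⊆ F := by
  refine ⟨⋃ t ∈ {e | e ∈ Dg ∧ T • e ∉ Dg},
    ({z | (∃ k : ℕ, 0 < k ∧ T ^ k • t.2 = t.2) ∧ ∃ n : ℤ, z = T ^ n • t.2} ∪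
     {z | (∃ k : ℕ, 0 < k ∧ T ^ k • t.1 = t.1) ∧ ∃ n : ℤ, toL z = T ^ n • t.1}), ?_, ?_⟩
  · refine Set.Finite.biUnion (Dg_comm T) (fun t _ => Set.Finite.union ?_ ?_)
    · by_cases h : ∃ k : ℕ, 0 < k ∧ T ^ k • t.2 = t.2
      · obtain ⟨k, hk, hk'⟩ := h
        exact (per_orbit_finite hk hk').subset (fun z hz => hz.2)
      · exact Set.finite_empty.subset (fun z hz => h hz.1)
    · by_cases h : ∃ k : ℕ, 0 < k ∧ T ^ k • t.1 = t.1
      · obtain ⟨k, hk, hk'⟩ := h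
        exact ((per_orbit_finite hk hk').preimage toL_injective.injOn).subset (fun z hz => hz.2)
      · exact Set.finite_empty.subset (fun z hz => h hz.1)
  · intro k hk x hx
    have hx : ¬ (T ^ k • x = x ↔ T ^ k • toL x = toL x) := by
      rw [← mem_LX_fixS]; exact hx
    have hne : T ^ k • toL x ≠ toL (T ^ k • x) := by
      intro heq
      apply hx
      rw [heq]
      exact ⟨fun h => by rw [h], fun h => toL_injective h⟩
    obtain ⟨n, hn1, hn2⟩ := exists_exit (D := Dg) (a := T) (e := (toL x, x)) (m := 0) (n := k)
      (by omega) (by simp [mem_Dg]) (by rw [zpow_natCast]; exact hne)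
    simp only [Set.mem_iUnion]
    refine ⟨_, ⟨hn1, hn2⟩, ?_⟩
    have hcomm : ∀ {E : Type} [MulAction IETG E] (y : E), T ^ k • y = y →
        T ^ k • T ^ n • y = T ^ n • y := by
      intro E _ y hy
      rw [← mul_smul, ← zpow_natCast, ← zpow_add, add_comm, zpow_add, mul_smul, zpow_natCast, hy]
    by_cases hk' : T ^ k • x = x
    · left
      exact ⟨⟨k, hk, hcomm x hk'⟩, -n, by
        show x = T ^ (-n) • T ^ n • x
        rw [← mul_smul, ← zpow_add]; simp⟩
    · have hk2 : T ^ k • toL x = toL x := by tauto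
      right
      exact ⟨⟨k, hk, hcomm (toL x) hk2⟩, -n, by
        show toL x = T ^ (-n) • T ^ n • toL x
        rw [← mul_smul, ← zpow_add]; simp⟩

theorem per_eq (T : IETG) : ∃ k : ℕ, 0 < k ∧ ∀ x : I01, ∀ n : ℕ, 0 < n → T ^ n • x = x →
    T ^ k • x = x := by
  obtain ⟨F, hF, h⟩ := fix_bd_finite T
  have hfin : {X | ∃ k : ℕ, 0 < k ∧ X = fixS (T ^ k)}.Finite := by
    refine (finite_of_bd hF).subset ?_
    rintro X ⟨k, hk, rfl⟩
    exact ⟨fixS_step _, h k hk⟩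
  obtain ⟨X, ⟨k, hk, rfl⟩, hmax⟩ := hfin.exists_maximal ⟨_, 1, one_pos, rfl⟩
  refine ⟨k, hk, fun x n hn hx => ?_⟩
  have h1 : fixS (T ^ k) ≤ fixS (T ^ (k * n)) := fun y hy => pow_fix hy n
  exact hmax ⟨k * n, Nat.mul_pos hk hn, rfl⟩ h1 (pow_fix' hx k)

theorem Ap_LX {a : IETG} {C : Set I01} (h : ∀ x ∈ C, Ap a x) {x : LI} (hx : x ∈ LX C) : Ap a x := by
  intro n hn h1
  have h2 := mem_LX_fixS.2 h1
  have h3 : x ∈ LX (C ∩ fixS (a ^ n)) := by rw [LX_inter]; exact ⟨hx, h2⟩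
  obtain ⟨y, hy1, hy2⟩ := LX_nonempty h3
  exact h y hy1 n hn hy2

/-- virtually invariant -/
def VI (a : IETG) (X : Set I01) : Prop := ∃ k : ℕ, 0 < k ∧ a ^ k • X = X

theorem VI.inter {a : IETG} {X Y : Set I01} (hX : VI a X) (hY : VI a Y) : VI a (X ∩ Y) := by
  obtain ⟨k, hk, h1⟩ := hX
  obtain ⟨l, hl, h2⟩ := hY
  refine ⟨k * l, Nat.mul_pos hk hl, ?_⟩
  rw [Set.smul_set_inter, pow_fix h1, pow_fix' h2]

theorem VI.pow {a : IETG} {X : Set I01} (h : VI a X) (k : ℕ) : VI (a ^ k) X := by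
  obtain ⟨l, hl, h1⟩ := h
  exact ⟨l, hl, by rw [← pow_mul]; exact pow_fix' h1 k⟩

theorem VI.of_pow {a : IETG} {X : Set I01} {k : ℕ} (hk : 0 < k) (h : VI (a ^ k) X) : VI a X := by
  obtain ⟨l, hl, h1⟩ := h
  exact ⟨k * l, Nat.mul_pos hk hl, by rw [pow_mul]; exact h1⟩

theorem pow_inv_fix {a : IETG} {X : Set I01} {k : ℕ} (h : a ^ k • X = X) : a⁻¹ ^ k • X = X := by
  rw [inv_pow, inv_smul_eq_iff]; exact h.symm

theorem VI.inv {a : IETG} {X : Set I01} (h : VI a X) : VI a⁻¹ X := by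
  obtain ⟨l, hl, h1⟩ := h
  exact ⟨l, hl, pow_inv_fix h1⟩

theorem VI.conj {a : IETG} {X : Set I01} (h : VI a X) (g : IETG) : VI (g * a * g⁻¹) (g • X) := by
  obtain ⟨l, hl, h1⟩ := h
  exact ⟨l, hl, by rw [conj_pow_smul, h1]⟩

theorem bd_smul_mem {g : IETG} {X : Set I01} (hg : g • X = X) {x : I01} (hx : x ∈ bd X)
    (hd : g • toL x = toL (g • x)) : g • x ∈ bd X := by
  intro h
  apply hx
  rw [← hd] at h
  nth_rewrite 1 [← hg] at h
  nth_rewrite 2 [← hg] at h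
  rwa [mem_LX_smul, Set.smul_mem_smul_set_iff] at h

theorem not_end_bd {a : IETG} {X : Set I01} (hX : StepS X) {k : ℕ} (hk : 0 < k)
    (h : a ^ k • X = X) {x : I01} (hx : x ∈ bd X) (hap : Ap a (toL x, x)) :
    ¬ End Dg a (toL x, x) := by
  intro hE
  rw [← End.pow_iff Dg_comm hap hk] at hE
  have h1 := (hap.pow hk).eventually ((bd_finite hX).image (fun z => (toL z, z)))
  obtain ⟨n, hn1, hn2⟩ := (h1.and hE).exists
  apply hn1
  have hn2 : (a ^ k) ^ n • toL x = toL ((a ^ k) ^ n • x) := hn2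
  refine ⟨(a ^ k) ^ n • x, bd_smul_mem ?_ hx hn2, ?_⟩
  · rw [← pow_mul]; exact pow_fix h n
  · exact Prod.ext hn2.symm rfl

theorem vi_bd (a : IETG) : ∃ F : Set I01, F.Finite ∧ ∀ X, StepS X → (∀ x ∈ X, Ap a x) → VI a X →
    bd X ⊆ F := by
  refine ⟨_, (finite_trans Dg_comm a).image Prod.snd, ?_⟩
  rintro X hX hap ⟨k, hk, h⟩ x hx
  have hape : Ap a ((toL x, x) : LI × I01) := by
    by_cases hxX : x ∈ X
    · exact Ap.of_snd (e := (toL x, x)) (hap x hxX)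
    · have : toL x ∈ LX X := by
        by_contra hcon
        exact hx ⟨fun h => absurd h hxX, fun h => absurd h hcon⟩
      exact Ap.of_fst (e := (toL x, x)) (Ap_LX hap this)
  exact ⟨(toL x, x), ⟨rfl, hape, not_end_bd hX hk h hx hape,
    not_end_bd hX hk (pow_inv_fix h) hx hape.inv⟩, rfl⟩

structure Atom (a : IETG) (C : Set I01) : Prop where
  step : StepS C
  ne : C.Nonempty
  ap : ∀ x ∈ C, Ap a x
  vi : VI a C
  min : ∀ X ⊆ C, StepS X → VI a X → X.Nonempty → X = C

theorem exists_atom (a : IETG) (ha : ∀ n : ℕ, 0 < n → a ^ n ≠ 1) : ∃ C, Atom a C := by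
  obtain ⟨F, hF, hbd⟩ := vi_bd a
  have hfin : {X | StepS X ∧ X.Nonempty ∧ (∀ x ∈ X, Ap a x) ∧ VI a X}.Finite :=
    (finite_of_bd hF).subset (fun X hX => ⟨hX.1, hbd X hX.1 hX.2.2.1 hX.2.2.2⟩)
  obtain ⟨k, hk, hper⟩ := per_eq a
  have hne : {X | StepS X ∧ X.Nonempty ∧ (∀ x ∈ X, Ap a x) ∧ VI a X}.Nonempty := by
    refine ⟨(fixS (a ^ k))ᶜ, (fixS_step _).compl, ?_, ?_, k, hk, ?_⟩
    · by_contra hcon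
      rw [Set.not_nonempty_iff_eq_empty, Set.compl_empty_iff] at hcon
      apply ha k hk
      apply Subtype.ext
      apply Equiv.ext
      intro x
      have : x ∈ fixS (a ^ k) := by rw [hcon]; trivial
      exact this
    · intro x hx n hn h1
      exact hx (hper x n hn h1)
    · rw [Set.smul_set_compl]
      congr 1
      ext x
      rw [Set.mem_smul_set_iff_inv_smul_mem]
      show a ^ k • (a ^ k)⁻¹ • x = (a ^ k)⁻¹ • x ↔ a ^ k • x = x
      rw [smul_inv_smul, eq_inv_smul_iff]
  obtain ⟨C, ⟨h1, h2, h3, h4⟩, hmin⟩ := hfin.exists_minimal hne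
  exact ⟨C, h1, h2, h3, h4, fun X hXC hX hvi hne' => le_antisymm hXC
    (hmin ⟨hX, hne', fun x hx => h3 x (hXC hx), hvi⟩ hXC)⟩

theorem Atom.pow {a : IETG} {C : Set I01} (h : Atom a C) {k : ℕ} (hk : 0 < k) : Atom (a ^ k) C :=
  ⟨h.step, h.ne, fun x hx => (h.ap x hx).pow hk, h.vi.pow k,
    fun X hX hs hv => h.min X hX hs (hv.of_pow hk)⟩

theorem Atom.inv {a : IETG} {C : Set I01} (h : Atom a C) : Atom a⁻¹ C :=
  ⟨h.step, h.ne, fun x hx => (h.ap x hx).inv, h.vi.inv,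
    fun X hX hs hv => h.min X hX hs (by have := hv.inv; rwa [inv_inv] at this)⟩

theorem Atom.conj {a : IETG} {C : Set I01} (h : Atom a C) (g : IETG) :
    Atom (g * a * g⁻¹) (g • C) := by
  refine ⟨h.step.smul g, h.ne.smul_set, ?_, h.vi.conj g, ?_⟩
  · rintro _ ⟨x, hx, rfl⟩
    exact (h.ap x hx).conj g
  · intro X hX hs hv hne
    have h1 := h.min (g⁻¹ • X) (by rwa [Set.smul_set_subset_iff_subset_inv_smul_set, inv_inv])
      (hs.smul _) (by have := hv.conj g⁻¹; simpa [mul_assoc] using this) hne.smul_set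
    rw [← h1, smul_inv_smul]

theorem Atom.eq_of_inter {a : IETG} {C D : Set I01} (h : Atom a C) (h' : Atom a D)
    (hne : (C ∩ D).Nonempty) : C = D :=
  (h.min (C ∩ D) Set.inter_subset_left (h.step.inter h'.step) (h.vi.inter h'.vi) hne).symm.trans
    (h'.min (C ∩ D) Set.inter_subset_right (h.step.inter h'.step) (h.vi.inter h'.vi) hne)

theorem finite_of_disjoint {S : Set (Set I01)} {C : Set I01} (hC : StepS C) (hne : C.Nonempty)
    (hS : ∀ X ∈ S, ∃ g : IETG, X = g • C)
    (hd : ∀ X ∈ S, ∀ Y ∈ S, (X ∩ Y).Nonempty → X = Y) : S.Finite := by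
  have := MeasureTheory.Measure.finite_const_le_meas_of_disjoint_iUnion mI
    (mI_pos_of_step hC hne) (As := fun X : S => (X : Set I01)) (by
      rintro ⟨X, hX⟩
      obtain ⟨g, rfl⟩ := hS X hX
      exact (hC.smul g).measurable) (by
      rintro ⟨X, hX⟩ ⟨Y, hY⟩ hne'
      rw [Function.onFun, Set.disjoint_iff_inter_eq_empty]
      by_contra hcon
      exact hne' (Subtype.ext (hd X hX Y hY (Set.nonempty_iff_ne_empty.2 hcon))))
    (MeasureTheory.measure_ne_top _ _)
  have h2 : {i : S | mI C ≤ mI (i : Set I01)} = Set.univ := by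
    ext ⟨X, hX⟩
    simp only [Set.mem_univ, iff_true]
    obtain ⟨g, rfl⟩ := hS X hX
    exact (mI_smul hC g).ge
  rw [h2] at this
  exact Set.finite_coe_iff.1 (Set.finite_univ_iff.1 this)

theorem exists_pow_fix {b : IETG} {C : Set I01} (hC : StepS C) (hne : C.Nonempty)
    (hd : ∀ n : ℕ, (b ^ n • C ∩ C).Nonempty → b ^ n • C = C) : ∃ m : ℕ, 0 < m ∧ b ^ m • C = C := by
  have key : ∀ m n : ℕ, m ≤ n → (b ^ m • C ∩ b ^ n • C).Nonempty → b ^ (n - m) • C = C := by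
    intro m n hmn h
    apply hd
    obtain ⟨x, h1, h2⟩ := h
    refine ⟨(b ^ m)⁻¹ • x, ?_, by rwa [Set.mem_smul_set_iff_inv_smul_mem] at h1⟩
    have : b ^ n = b ^ m * b ^ (n - m) := by rw [← pow_add]; congr 1; omega
    rw [this, mul_smul, Set.mem_smul_set_iff_inv_smul_mem] at h2
    exact h2
  have key2 : ∀ m n : ℕ, m ≤ n → (b ^ m • C ∩ b ^ n • C).Nonempty → b ^ m • C = b ^ n • C := by
    intro m n hmn h
    have h1 := key m n hmn h
    have : b ^ n = b ^ m * b ^ (n - m) := by rw [← pow_add]; congr 1; omega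
    rw [this, mul_smul, h1]
  have hfin : (Set.range (fun n : ℕ => b ^ n • C)).Finite := by
    refine finite_of_disjoint hC hne ?_ ?_
    · rintro _ ⟨n, rfl⟩
      exact ⟨b ^ n, rfl⟩
    · rintro _ ⟨m, rfl⟩ _ ⟨n, rfl⟩ h
      rcases le_total m n with hmn | hmn
      · exact key2 m n hmn h
      · rw [Set.inter_comm] at h
        exact (key2 n m hmn h).symm
  obtain ⟨m, n, hmn, heq⟩ : ∃ m n : ℕ, m < n ∧ b ^ m • C = b ^ n • C := by
    by_contra hcon
    push Not at hcon
    refine Set.infinite_range_of_injective (f := fun n : ℕ => b ^ n • C) ?_ hfin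
    intro m n h
    rcases lt_trichotomy m n with h1 | h1 | h1
    · exact absurd h (hcon _ _ h1)
    · exact h1
    · exact absurd h.symm (hcon _ _ h1)
  refine ⟨n - m, by omega, key m n hmn.le ?_⟩
  rw [← heq, Set.inter_self]
  exact hne.smul_set

theorem Atom.overlap_sub {a b : IETG} {C D : Set I01} (h : Atom a C) (h' : Atom b D) {k : ℕ}
    (hk : 0 < k) (hab : Commute (a ^ k) (b ^ k)) (hne : (C ∩ D).Nonempty) : D ⊆ C := by
  obtain ⟨m, hm, hm'⟩ := exists_pow_fix (b := b ^ k) h.step h.ne (by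
    intro n hn
    have h1 := h.pow hk
    have h2 := h1.conj ((b ^ k) ^ n)
    rw [← (hab.pow_right n).eq, mul_inv_cancel_right] at h2
    exact h2.eq_of_inter h1 hn)
  have hv : VI b C := ⟨k * m, Nat.mul_pos hk hm, by rw [pow_mul]; exact hm'⟩
  have := h'.min (C ∩ D) Set.inter_subset_right (h.step.inter h'.step) (hv.inter h'.vi) hne
  rw [← this]
  exact Set.inter_subset_left

theorem Atom.overlap {a b : IETG} {C D : Set I01} (h : Atom a C) (h' : Atom b D) {k : ℕ}
    (hk : 0 < k) (hab : Commute (a ^ k) (b ^ k)) (hne : (C ∩ D).Nonempty) : C = D :=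
  le_antisymm (h'.overlap_sub h hk hab.symm (by rwa [Set.inter_comm]))
    (h.overlap_sub h' hk hab hne)

theorem Atom.fix_all {a φ : IETG} {C : Set I01} (h : Atom a C) {k : ℕ} (hk : 0 < k)
    (hc : Commute φ (a ^ k)) {x : I01} (hx : x ∈ C) (hfx : φ • x = x) : ∀ y ∈ C, φ • y = y := by
  have hv : VI a (fixS φ) := by
    refine ⟨k, hk, ?_⟩
    ext y
    rw [Set.mem_smul_set_iff_inv_smul_mem]
    show φ • (a ^ k)⁻¹ • y = (a ^ k)⁻¹ • y ↔ φ • y = y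
    rw [← mul_smul, hc.inv_right.eq, mul_smul]
    exact ⟨fun h => smul_left_cancel _ h, fun h => by rw [h]⟩
  have := h.min (fixS φ ∩ C) Set.inter_subset_right ((fixS_step φ).inter h.step) (hv.inter h.vi)
    ⟨x, hfx, hx⟩
  intro y hy
  rw [← this] at hy
  exact hy.1

/-! ### Case 1 -/

theorem finite_trans2 {Γ : Type*} [Group Γ] {E : Type*} [MulAction Γ E] {D : Set E}
    (hD : CommS Γ D) (a : Γ) :
    {e | e ∈ D ∧ Ap a e ∧ ¬ (∀ n : ℕ, a ^ n • e ∈ D) ∧ ¬ End D a⁻¹ e}.Finite := by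
  have hfin : (⋃ t ∈ {t | (t ∈ D ∧ a • t ∉ D) ∧ Ap a t ∧ ¬ End D a⁻¹ t},
      (fun n : ℕ => a⁻¹ ^ n • t) '' {n : ℕ | a⁻¹ ^ n • t ∈ D}).Finite := by
    refine Set.Finite.biUnion ((hD a).subset (fun t ht => ht.1)) ?_
    rintro t ⟨-, ht, h2⟩
    apply Set.Finite.image
    have h2' := (End.dich hD ht.inv).resolve_left h2
    obtain ⟨M, hM⟩ := eventually_atTop.1 h2'
    refine (Set.finite_Iic M).subset ?_
    intro n hn
    by_contra hcon
    exact hM n (not_le.1 hcon).le hn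
  refine hfin.subset ?_
  rintro e ⟨heD, hap, h1, h2⟩
  push Not at h1
  obtain ⟨n, hn⟩ := h1
  have : ∃ k : ℕ, a ^ k • e ∈ D ∧ a • a ^ k • e ∉ D := by
    induction n with
    | zero => exact absurd (by simpa using heD) hn
    | succ n ih =>
      by_cases h : a ^ n • e ∈ D
      · exact ⟨n, h, by rwa [← mul_smul, ← pow_succ']⟩
      · exact ih h
  obtain ⟨k, hk1, hk2⟩ := this
  have e1 : a⁻¹ ^ k • a ^ k • e = e := by rw [inv_pow, inv_smul_smul]
  simp only [Set.mem_iUnion]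
  refine ⟨a ^ k • e, ⟨⟨hk1, hk2⟩, ?_, ?_⟩, k, ?_, e1⟩
  · have := hap.self_zpow k
    rwa [zpow_natCast] at this
  · rwa [← zpow_natCast, End.zpow_iff' hD hap]
  · show a⁻¹ ^ k • a ^ k • e ∈ D
    rwa [e1]

theorem relIndex_stab {Γ : Type*} [Group Γ] {X : Type*} [MulAction Γ X] (H : Subgroup Γ) (x : X)
    (h : {y | ∃ g ∈ H, y = g • x}.Finite) : (MulAction.stabilizer Γ x).relIndex H ≠ 0 := by
  have h1 : (MulAction.stabilizer Γ x).subgroupOf H = MulAction.stabilizer H x := by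
    ext g
    rfl
  rw [Subgroup.relIndex, h1, MulAction.index_stabilizer]
  have h2 : (MulAction.orbit H x).Finite := by
    refine h.subset ?_
    rintro _ ⟨g, rfl⟩
    exact ⟨g, g.2, rfl⟩
  exact (Set.ncard_pos h2).2 (MulAction.nonempty_orbit x) |>.ne'

def EC (C : Set I01) : Set (LI × I01) := {e | e.1 ∈ LX C ∧ e.2 ∈ C}

def SP (a : IETG) (C : Set I01) : Set (LI × I01) :=
  {e | e ∈ EC C ∧ End Dg a e ∧ ¬ End Dg a⁻¹ e}

theorem EC_smul {g : IETG} {C : Set I01} (hg : g • C = C) {e : LI × I01} :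
    g • e ∈ EC C ↔ e ∈ EC C := by
  show (g • e.1 ∈ LX C ∧ g • e.2 ∈ C) ↔ (e.1 ∈ LX C ∧ e.2 ∈ C)
  nth_rewrite 1 [← hg]
  nth_rewrite 2 [← hg]
  rw [mem_LX_smul, Set.smul_mem_smul_set_iff]

theorem Ap_EC {a : IETG} {C : Set I01} (h : ∀ x ∈ C, Ap a x) {e : LI × I01} (he : e ∈ EC C) :
    Ap a e := Ap.of_snd (h _ he.2)

theorem EC_congr {φ ψ : IETG} {C : Set I01} (h : ∀ x ∈ C, φ • x = ψ • x) {e : LI × I01}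
    (he : e ∈ EC C) : φ • e = ψ • e :=
  Prod.ext (smul_congr_LX h he.1) (h _ he.2)

theorem fix_zpow {g : IETG} {C : Set I01} (hg : g • C = C) (n : ℤ) : g ^ n • C = C :=
  Subgroup.zpow_mem (MulAction.stabilizer IETG C) hg n

theorem fix_pow {g : IETG} {C : Set I01} (hg : g • C = C) (n : ℕ) : g ^ n • C = C :=
  Subgroup.pow_mem (MulAction.stabilizer IETG C) hg n

theorem fix_inv {g : IETG} {C : Set I01} (hg : g • C = C) : g⁻¹ • C = C :=
  Subgroup.inv_mem (MulAction.stabilizer IETG C) hg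

theorem mem_of_fix {g : IETG} {C : Set I01} (hg : g • C = C) {x : I01} (hx : x ∈ C) : g • x ∈ C := by
  rw [← hg]; exact Set.smul_mem_smul_set hx

theorem agree_pow {φ ψ : IETG} {C : Set I01} (h : ∀ x ∈ C, φ • x = ψ • x) (hψ : ψ • C = C)
    (n : ℕ) : ∀ x ∈ C, φ ^ n • x = ψ ^ n • x := by
  induction n with
  | zero => simp
  | succ n ih =>
    intro x hx
    rw [pow_succ, mul_smul, pow_succ, mul_smul, h x hx]
    exact ih _ (mem_of_fix hψ hx)

theorem agree_inv {φ ψ : IETG} {C : Set I01} (h : ∀ x ∈ C, φ • x = ψ • x) (hψ : ψ • C = C) :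
    ∀ x ∈ C, φ⁻¹ • x = ψ⁻¹ • x := by
  intro x hx
  rw [inv_smul_eq_iff, h _ (mem_of_fix (fix_inv hψ) hx), smul_inv_smul]

theorem agree_zpow {φ ψ : IETG} {C : Set I01} (h : ∀ x ∈ C, φ • x = ψ • x) (hψ : ψ • C = C)
    (n : ℤ) : ∀ x ∈ C, φ ^ n • x = ψ ^ n • x := by
  obtain ⟨k, rfl | rfl⟩ := n.eq_nat_or_neg
  · simpa using agree_pow h hψ k
  · have := agree_pow (agree_inv h hψ) (fix_inv hψ) k
    simpa using this

theorem End_agree {φ ψ : IETG} {C : Set I01} (h : ∀ x ∈ C, φ • x = ψ • x) (hψ : ψ • C = C)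
    {e : LI × I01} (he : e ∈ EC C) : End Dg φ e ↔ End Dg ψ e := by
  unfold End
  have : ∀ n : ℕ, φ ^ n • e = ψ ^ n • e := fun n => EC_congr (agree_pow h hψ n) he
  simp only [this]

theorem SP_agree {φ ψ : IETG} {C : Set I01} (h : ∀ x ∈ C, φ • x = ψ • x) (hψ : ψ • C = C) :
    SP φ C = SP ψ C := by
  ext e
  unfold SP
  simp only [Set.mem_ofPred_eq]
  constructor
  · rintro ⟨h1, h2, h3⟩
    exact ⟨h1, (End_agree h hψ h1).1 h2, by
      rwa [← End_agree (agree_inv h hψ) (fix_inv hψ) h1]⟩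
  · rintro ⟨h1, h2, h3⟩
    exact ⟨h1, (End_agree h hψ h1).2 h2, by
      rwa [End_agree (agree_inv h hψ) (fix_inv hψ) h1]⟩

theorem SP_pow {a : IETG} {C : Set I01} (h : ∀ x ∈ C, Ap a x) {k : ℕ} (hk : 0 < k) :
    SP (a ^ k) C = SP a C := by
  ext e
  unfold SP
  simp only [Set.mem_ofPred_eq]
  refine and_congr_right (fun he => ?_)
  have hap := Ap_EC h he
  rw [End.pow_iff Dg_comm hap hk, ← inv_pow, End.pow_iff Dg_comm hap.inv hk]

theorem SP_conj {a : IETG} {C : Set I01} (h : ∀ x ∈ C, Ap a x) {g : IETG} (hg : g • C = C) :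
    g • SP a C = SP (g * a * g⁻¹) C := by
  ext e
  rw [Set.mem_smul_set_iff_inv_smul_mem]
  obtain ⟨f, rfl⟩ : ∃ f, e = g • f := ⟨g⁻¹ • e, by rw [smul_inv_smul]⟩
  rw [inv_smul_smul]
  unfold SP
  simp only [Set.mem_ofPred_eq]
  rw [EC_smul hg]
  refine and_congr_right (fun he => ?_)
  have hap := Ap_EC h he
  rw [End.conj_iff Dg_comm hap, show (g * a * g⁻¹)⁻¹ = g * a⁻¹ * g⁻¹ by group,
    End.conj_iff Dg_comm hap.inv]

theorem SP_comm {a b : IETG} {C : Set I01} (h : ∀ x ∈ C, Ap a x) (hb : b • C = C)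
    (hab : Commute b a) : b • SP a C = SP a C := by
  rw [SP_conj h hb, hab.eq, mul_inv_cancel_right]

theorem lemma_V {a x : IETG} {C : Set I01} (h : Atom a C) (ha : a • C = C)
    (hne : (SP a C).Nonempty) (hx : x • C = C) {k : ℕ} (hk : 0 < k)
    (hc : Commute (x ^ k) (a ^ k)) :
    ∃ p : ℕ, 0 < p ∧ ∃ j : ℤ, ∀ y ∈ C, x ^ p • y = a ^ j • y := by
  obtain ⟨e, he⟩ := hne
  have hk0 : (k : ℤ) ≠ 0 := by omega
  have hSP : ∀ i : ℕ, (x ^ k) ^ i • e ∈ SP a C := by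
    intro i
    have h1 : (x ^ k) ^ i • SP a C = SP a C := by
      rw [← SP_pow h.ap hk]
      exact SP_comm (h.pow hk).ap (fix_pow (fix_pow hx k) i) (hc.pow_left i)
    rw [← h1]
    exact Set.smul_mem_smul_set he
  have hT : ∀ i : ℕ, ∃ n : ℤ, a ^ n • (x ^ k) ^ i • e ∈ {e | e ∈ Dg ∧ a⁻¹ • e ∉ Dg} := by
    intro i
    exact (hSP i).2.1.enter (hSP i).2.2
  choose n hn using hT
  have hfin : ({e | e ∈ Dg ∧ a⁻¹ • e ∉ Dg} ×ˢ Set.Ico (0 : ℤ) k).Finite :=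
    (Dg_comm a⁻¹).prod (Set.finite_Ico _ _)
  obtain ⟨i, i', hii, heq⟩ : ∃ i i' : ℕ, i < i' ∧
      (a ^ n i • (x ^ k) ^ i • e, n i % k) = (a ^ n i' • (x ^ k) ^ i' • e, n i' % k) := by
    by_contra hcon
    push Not at hcon
    refine Set.infinite_of_injective_forall_mem
      (f := fun i => (a ^ n i • (x ^ k) ^ i • e, n i % (k : ℤ))) ?_ (fun i => ?_) hfin
    · intro m n h
      rcases lt_trichotomy m n with h1 | h1 | h1
      · exact absurd h (hcon _ _ h1)
      · exact h1
      · exact absurd h.symm (hcon _ _ h1)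
    · exact ⟨hn i, Int.emod_nonneg _ hk0, Int.emod_lt_of_pos _ (by omega)⟩
  obtain ⟨h1, h2⟩ := Prod.ext_iff.1 heq
  simp only at h1 h2
  obtain ⟨j, hj⟩ : (k : ℤ) ∣ n i - n i' := by
    rw [← Int.emod_emod_of_dvd (n i) (dvd_refl (k : ℤ))] at h2
    exact Int.ModEq.dvd (by rw [Int.ModEq]; simpa using h2.symm)
  have h3 : (x ^ k) ^ i' • e = (a ^ k) ^ j • (x ^ k) ^ i • e := by
    rw [← zpow_natCast a, ← zpow_mul, ← hj, sub_eq_add_neg, add_comm, zpow_add, mul_smul, h1,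
      ← mul_smul, ← zpow_add, neg_add_cancel, zpow_zero, one_smul]
  set f := (x ^ k) ^ i • e with hf
  have h4 : (x ^ k) ^ (i' - i) • f = (a ^ k) ^ j • f := by
    rw [← h3, hf, ← mul_smul, ← pow_add]
    congr 3; omega
  have h5 := h.fix_all (φ := ((a ^ k) ^ j)⁻¹ * (x ^ k) ^ (i' - i)) hk
    (((Commute.refl (a ^ k)).zpow_left j).inv_left.mul_left (hc.pow_left _)) (hSP i).1.2
    (by rw [mul_smul, inv_smul_eq_iff]; exact congrArg Prod.snd h4)
  refine ⟨k * (i' - i), Nat.mul_pos hk (by omega), k * j, fun y hy => ?_⟩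
  have := h5 y hy
  rw [mul_smul, inv_smul_eq_iff] at this
  rw [pow_mul, this, zpow_mul, zpow_natCast]

theorem case1 (H N : Subgroup IETG) (hNH : N ≤ H) (hnorm : ∀ g ∈ H, ∀ n ∈ N, g * n * g⁻¹ ∈ N)
    (hcomm : ∀ g ∈ H, ∀ h ∈ H, g * h * g⁻¹ * h⁻¹ ∈ N)
    (hpc : ∀ x ∈ N, ∀ y ∈ N, ∃ k : ℕ, 0 < k ∧ Commute (x ^ k) (y ^ k))
    {a : IETG} (haN : a ∈ N) {C : Set I01} (h : Atom a C) (ha : a • C = C)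
    (hne : (SP a C).Nonempty) :
    ∃ K : Subgroup IETG, K.relIndex (H ⊓ MulAction.stabilizer IETG C) ≠ 0 ∧
      ∀ g ∈ K, ∀ h ∈ K, ∃ p : ℕ, 0 < p ∧ ∃ x ∈ C, (g * h * g⁻¹ * h⁻¹) ^ p • x = x := by
  set HC := H ⊓ MulAction.stabilizer IETG C with hHC
  have horb : ∀ g ∈ HC, g • SP a C = SP a C ∨ g • SP a C = SP a⁻¹ C := by
    rintro g ⟨hg, hgC⟩
    have hgC : g • C = C := hgC
    have hb := hnorm g hg a haN
    have hbC : (g * a * g⁻¹) • C = C := by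
      rw [mul_smul, mul_smul, fix_inv hgC, ha, hgC]
    have hbat := h.conj g
    rw [hgC] at hbat
    obtain ⟨k, hk, hk'⟩ := hpc _ hb _ haN
    obtain ⟨p, hp, j, hj⟩ := lemma_V h ha hne hbC hk hk'
    have e1 : g • SP a C = SP (a ^ j) C := by
      rw [SP_conj h.ap hgC, ← SP_pow hbat.ap hp, SP_agree hj (fix_zpow ha j)]
    rw [e1]
    obtain ⟨m, rfl | rfl⟩ := j.eq_nat_or_neg
    all_goals
      rcases Nat.eq_zero_or_pos m with rfl | hm
      · exfalso
        obtain ⟨y, hy⟩ := h.ne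
        have := hj y hy
        simp only [Nat.cast_zero, neg_zero, zpow_zero, one_smul] at this
        exact hbat.ap y hy p hp this
    · left; rw [zpow_natCast, SP_pow h.ap hm]
    · right; rw [zpow_neg, zpow_natCast, ← inv_pow, SP_pow h.inv.ap hm]
  refine ⟨HC ⊓ MulAction.stabilizer IETG (SP a C), ?_, ?_⟩
  · rw [Subgroup.inf_relIndex_left]
    apply relIndex_stab
    refine (Set.toFinite {SP a C, SP a⁻¹ C}).subset ?_
    rintro _ ⟨g, hg, rfl⟩
    exact horb g hg
  set K := HC ⊓ MulAction.stabilizer IETG (SP a C) with hK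
  have haK : a ∈ K := ⟨⟨hNH haN, ha⟩, SP_comm h.ap ha (Commute.refl a)⟩
  set P : Set (LI × I01) := {e | e ∈ SP a C ∧ ∀ n : ℕ, a ^ n • e ∈ Dg} with hP
  have hPK : ∀ g ∈ K, (g • P \ P).Finite := by
    intro g hg
    refine (((Dg_comm g).smul_set (a := g)).union (finite_trans2 Dg_comm a)).subset ?_
    rintro _ ⟨⟨f, hf, rfl⟩, hgf⟩
    have hf0 : f ∈ Dg := by simpa using hf.2 0
    simp only at hgf ⊢
    by_cases hD : g • f ∈ Dg
    · right
      have hSP : g • f ∈ SP a C := by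
        have : g • SP a C = SP a C := hg.2
        rw [← this]; exact Set.smul_mem_smul_set hf.1
      exact ⟨hD, Ap_EC h.ap hSP.1, fun hcon => hgf ⟨hSP, hcon⟩, hSP.2.2⟩
    · left
      exact Set.smul_mem_smul_set ⟨hf0, hD⟩
  have haSP : a • SP a C = SP a C := haK.2
  have haP : a • P ⊆ P := by
    rintro _ ⟨f, hf, rfl⟩
    refine ⟨by rw [← haSP]; exact Set.smul_mem_smul_set hf.1, fun n => ?_⟩
    show a ^ n • a • f ∈ Dg
    rw [← mul_smul, ← pow_succ]; exact hf.2 (n + 1)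
  have haP' : a • P ⊂ P := by
    refine ⟨haP, fun hcon => ?_⟩
    have heq : a • P = P := le_antisymm haP hcon
    obtain ⟨e, he⟩ := hne
    obtain ⟨M, hM⟩ := eventually_atTop.1 he.2.1
    have hfP : a ^ M • e ∈ P := by
      refine ⟨?_, fun n => ?_⟩
      · have : a ^ M • SP a C = SP a C :=
          Subgroup.pow_mem (MulAction.stabilizer IETG (SP a C)) haSP M
        rw [← this]; exact Set.smul_mem_smul_set he
      · rw [← mul_smul, ← pow_add]; exact hM _ (by omega)
    apply hfP.1.2.2
    refine Eventually.of_forall (fun n => ?_)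
    have h1 : a⁻¹ ^ n • P = P :=
      Subgroup.pow_mem (MulAction.stabilizer IETG P) (Subgroup.inv_mem _ heq) n
    have h2 : a⁻¹ ^ n • a ^ M • e ∈ P := by
      rw [← h1]; exact Set.smul_mem_smul_set hfP
    simpa using h2.2 0
  intro g hg g' hg'
  have hw : g * g' * g⁻¹ * g'⁻¹ ∈ N := hcomm g hg.1.1 g' hg'.1.1
  have hwC : (g * g' * g⁻¹ * g'⁻¹) • C = C :=
    (K.mul_mem (K.mul_mem (K.mul_mem hg hg') (K.inv_mem hg)) (K.inv_mem hg')).1.2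
  obtain ⟨k, hk, hk'⟩ := hpc _ hw _ haN
  obtain ⟨p, hp, j, hj⟩ := lemma_V h ha hne hwC hk hk'
  have hj0 : j = 0 := by
    refine tau_lemma hPK haK haP' hg hg' (p := p) ?_
    apply Set.image_congr
    intro e he
    exact EC_congr hj he.1.1
  obtain ⟨y, hy⟩ := h.ne
  refine ⟨p, hp, y, hy, ?_⟩
  rw [hj y hy, hj0, zpow_zero, one_smul]

/-! ### Case 2: the core argument -/

structure TW (C : Set I01) (τ : I01 → LI) : Prop where
  step : StepS C
  inj : ∀ z ∈ C, ∀ z' ∈ C, τ z = τ z' → z = z'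
  mem : ∀ z ∈ C, τ z ∈ LX C
  fin : {z | z ∈ C ∧ τ z ≠ toL z}.Finite
  erg : ∀ X ⊆ C, StepS X → (∀ z ∈ C, z ∈ X ↔ τ z ∈ LX X) → X.Nonempty → X = C

noncomputable def ind (x z : I01) : ℤ := by classical exact if z = x then 1 else 0

theorem ind_self (x : I01) : ind x x = 1 := by simp [ind]
theorem ind_ne {x z : I01} (h : z ≠ x) : ind x z = 0 := by simp [ind, h]

theorem ind_smul (g : IETG) (x z : I01) : ind (g • x) z = ind x (g⁻¹ • z) := by
  unfold ind
  simp only [inv_smul_eq_iff]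

def Arc (C : Set I01) (τ : I01 → LI) (f : I01 → ℤ) (x y : I01) : Prop :=
  Step f ∧ ∀ z ∈ C, ∀ᶠ u in (τ z).fil, f u = f z - ind x z + ind y z

section
variable {C : Set I01} {τ : I01 → LI}

theorem Arc.refl (x : I01) : Arc C τ (fun _ => 0) x x :=
  ⟨Step.const 0, fun z _ => Eventually.of_forall (fun u => by simp)⟩

theorem Arc.add {f g : I01 → ℤ} {x y z : I01} (h1 : Arc C τ f x y) (h2 : Arc C τ g y z) :
    Arc C τ (fun u => f u + g u) x z := by
  refine ⟨Step.map₂ h1.1 h2.1 (fun a b => a + b), fun v hv => ?_⟩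
  filter_upwards [h1.2 v hv, h2.2 v hv] with u e1 e2
  rw [e1, e2]; ring

theorem Arc.neg {f : I01 → ℤ} {x y : I01} (h1 : Arc C τ f x y) :
    Arc C τ (fun u => - f u) y x := by
  refine ⟨Step.map h1.1 (fun a => - a), fun v hv => ?_⟩
  filter_upwards [h1.2 v hv] with u e1
  rw [e1]; ring

/-- equivariance -/
def Eqv (C : Set I01) (τ : I01 → LI) (g : IETG) : Prop :=
  g • C = C ∧ ∀ z ∈ C, τ (g • z) = g • τ z

theorem Eqv.inv {g : IETG} (h : Eqv C τ g) : Eqv C τ g⁻¹ := by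
  refine ⟨fix_inv h.1, fun z hz => ?_⟩
  have := h.2 (g⁻¹ • z) (mem_of_fix (fix_inv h.1) hz)
  rw [smul_inv_smul] at this
  rw [this, inv_smul_smul]

theorem Eqv.mul {g h : IETG} (hg : Eqv C τ g) (hh : Eqv C τ h) : Eqv C τ (g * h) := by
  refine ⟨by rw [mul_smul, hh.1, hg.1], fun z hz => ?_⟩
  rw [mul_smul, mul_smul, hg.2 _ (mem_of_fix hh.1 hz), hh.2 z hz]

theorem Arc.smul {f : I01 → ℤ} {x y : I01} (h1 : Arc C τ f x y) {g : IETG} (hg : Eqv C τ g) :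
    Arc C τ (fun u => f (g⁻¹ • u)) (g • x) (g • y) := by
  refine ⟨Step.smul_comp h1.1 g⁻¹, fun v hv => ?_⟩
  have h2 := h1.2 (g⁻¹ • v) (mem_of_fix hg.inv.1 hv)
  rw [hg.inv.2 v hv, fil_smul, eventually_map] at h2
  rw [ind_smul, ind_smul]
  exact h2

theorem ico_left (s : I01) (r : ℝ) (w : I01) :
    ∀ᶠ u : I01 in lf w, ((s ≤ u ∧ (u : ℝ) < r) ↔ ((s : ℝ) < pt w ∧ pt w ≤ r)) := by
  rw [Filter.Eventually, mem_lf]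
  rcases le_or_gt (pt w) s with h1 | h1
  · refine ⟨0, le_rfl, pt_pos w, fun u _ hu => ?_⟩
    refine iff_of_false (fun h => ?_) (fun h => ?_)
    · have : (s : ℝ) ≤ u := h.1
      linarith
    · linarith [h.1]
  · rcases le_or_gt (pt w) r with h2 | h2
    · refine ⟨s, s.2.1, h1, fun u hu1 hu2 => ?_⟩
      exact iff_of_true ⟨show (s : ℝ) ≤ u from hu1.le, by linarith⟩ ⟨h1, h2⟩
    · refine ⟨max r 0, le_max_right _ _, max_lt h2 (pt_pos w), fun u hu1 hu2 => ?_⟩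
      have := (le_max_left r 0).trans_lt hu1
      refine iff_of_false (fun h => ?_) (fun h => ?_)
      · linarith [h.2]
      · linarith [h.2]

open Classical in
noncomputable def icof (s : I01) (r : ℝ) (u : I01) : ℤ := if s ≤ u ∧ (u : ℝ) < r then 1 else 0

theorem icof_one {s : I01} {r : ℝ} {u : I01} (h : s ≤ u ∧ (u : ℝ) < r) : icof s r u = 1 := if_pos h
theorem icof_zero {s : I01} {r : ℝ} {u : I01} (h : ¬ (s ≤ u ∧ (u : ℝ) < r)) : icof s r u = 0 :=
  if_neg h

theorem icof_step (s : I01) (r : ℝ) : Step (icof s r) := by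
  refine ⟨{z | z = s ∨ (z : ℝ) = r}, ?_, ?_⟩
  · refine (Set.Finite.union (Set.finite_singleton s)
      ((Set.finite_singleton r).preimage Subtype.val_injective.injOn)).subset ?_
    rintro z (h | h)
    · exact Or.inl h
    · exact Or.inr h
  · intro x y hxy hz
    have : (s ≤ x ∧ (x : ℝ) < r) ↔ (s ≤ y ∧ (y : ℝ) < r) := by
      constructor
      · rintro ⟨h1, h2⟩
        refine ⟨h1.trans hxy.le, ?_⟩
        by_contra hcon
        push Not at hcon
        have hx0 := x.2.1
        have hy1 := y.2.2
        exact hz ⟨r, by constructor <;> linarith⟩ (Or.inr rfl) ⟨h2, hcon⟩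
      · rintro ⟨h1, h2⟩
        refine ⟨?_, lt_trans hxy h2⟩
        by_contra hcon
        push Not at hcon
        exact hz s (Or.inl rfl) ⟨hcon, h1⟩
    unfold icof
    simp only [this]

theorem icof_arc_aux {s x y z : I01} {r : ℝ} {l : LI}
    (h : icof s r z - ind x z + ind y z = 1 ↔ ((s : ℝ) < pt l.base ∧ pt l.base ≤ r))
    (h' : icof s r z - ind x z + ind y z = 0 ↔ ¬ ((s : ℝ) < pt l.base ∧ pt l.base ≤ r)) :
    ∀ᶠ u in l.fil, icof s r u = icof s r z - ind x z + ind y z := by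
  have := ico_left s r l.base
  show ∀ᶠ u in lf l.base, _
  filter_upwards [this] with u hu
  by_cases hc : (s : ℝ) < pt l.base ∧ pt l.base ≤ r
  · rw [h.2 hc, icof_one (hu.2 hc)]
  · rw [h'.2 hc, icof_zero (fun h => hc (hu.1 h))]

/-- special points -/
def TWF (C : Set I01) (τ : I01 → LI) : Set I01 :=
  {z | z ∈ C ∧ τ z ≠ toL z} ∪ (fun z => (τ z).base) '' {z | z ∈ C ∧ τ z ≠ toL z} ∪ bd C ∪ {zeroI}

theorem TW.finF (h : TW C τ) : (TWF C τ).Finite :=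
  ((h.fin.union (h.fin.image _)).union (bd_finite h.step)).union (Set.finite_singleton _)

theorem TWF_cases (z : I01) (hz : z ∈ C) : (z ∈ TWF C τ ∧ (τ z).base ∈ TWF C τ) ∨ (τ z) = toL z := by
  by_cases h : τ z = toL z
  · exact Or.inr h
  · left
    exact ⟨Or.inl (Or.inl (Or.inl ⟨hz, h⟩)), Or.inl (Or.inl (Or.inr ⟨z, ⟨hz, h⟩, rfl⟩))⟩

theorem pt_eq_or (w : I01) : ((w : ℝ) = 0 ∧ pt w = 1) ∨ (0 < (w : ℝ) ∧ pt w = w) := by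
  rcases eq_or_lt_of_le w.2.1 with h | h
  · left; exact ⟨h.symm, by simp [pt, ← h]⟩
  · right; exact ⟨h, pt_of_pos h⟩

theorem arc1 {s t : I01} (hst : s < t)
    (hF : ∀ u ∈ TWF C τ, ¬ (s < u ∧ u ≤ t)) : Arc C τ (icof s t) s t := by
  refine ⟨icof_step _ _, fun z hz => ?_⟩
  have hst' : (s : ℝ) < t := hst
  have hs0 := s.2.1
  have ht1 := t.2.2
  have hval : ∀ w : I01, ((s : ℝ) < pt w ∧ pt w ≤ t) ↔ (s < w ∧ w ≤ t) := by
    intro w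
    show _ ↔ ((s : ℝ) < w ∧ (w : ℝ) ≤ t)
    rcases pt_eq_or w with ⟨h1, h2⟩ | ⟨h1, h2⟩
    · rw [h1, h2]; constructor <;> intro h <;> linarith [h.1, h.2]
    · rw [h2]
  have main : (s < (τ z).base ∧ (τ z).base ≤ t) ↔ (s < z ∧ z ≤ t) := by
    rcases TWF_cases (τ := τ) z hz with ⟨h1, h2⟩ | h
    · exact iff_of_false (hF _ h2) (hF _ h1)
    · rw [h]; rfl
  have comp : icof s t z - ind s z + ind t z = 1 ∧ (s < z ∧ z ≤ t) ∨
      icof s t z - ind s z + ind t z = 0 ∧ ¬ (s < z ∧ z ≤ t) := by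
    rcases lt_trichotomy z s with h | rfl | h
    · right
      rw [icof_zero (fun h' => absurd h'.1 (not_le.2 h)), ind_ne h.ne, ind_ne (h.trans hst).ne]
      exact ⟨by norm_num, fun h' => lt_asymm h h'.1⟩
    · right
      rw [icof_one ⟨le_rfl, hst'⟩, ind_self, ind_ne hst.ne]
      exact ⟨by norm_num, fun h' => lt_irrefl _ h'.1⟩
    · rcases lt_trichotomy z t with h1 | rfl | h1
      · left
        rw [icof_one ⟨h.le, h1⟩, ind_ne h.ne', ind_ne h1.ne]
        exact ⟨by norm_num, h, h1.le⟩
      · left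
        rw [icof_zero (fun h' => lt_irrefl _ h'.2), ind_self, ind_ne h.ne']
        exact ⟨by norm_num, h, le_rfl⟩
      · right
        rw [icof_zero (fun h' => lt_asymm h1 h'.2), ind_ne h.ne', ind_ne h1.ne']
        exact ⟨by norm_num, fun h' => absurd h'.2 (not_le.2 h1)⟩
  apply icof_arc_aux
  · rw [hval, main]
    rcases comp with ⟨h1, h2⟩ | ⟨h1, h2⟩ <;> rw [h1] <;> simp [h2]
  · rw [hval, main]
    rcases comp with ⟨h1, h2⟩ | ⟨h1, h2⟩ <;> rw [h1] <;> simp [h2]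

theorem arc2 (h : TW C τ) {y : I01} (hy : y ∈ C) {c : ℝ} (hc0 : 0 ≤ c)
    (hcF : ∀ u ∈ TWF C τ, (u : ℝ) < pt (τ y).base → (u : ℝ) ≤ c) {s : I01} (hcs : c < s)
    (hsw : (s : ℝ) < pt (τ y).base) : Arc C τ (icof s (pt (τ y).base)) s y := by
  refine ⟨icof_step _ _, fun z hz => ?_⟩
  set w := (τ y).base with hw
  have hw1 := pt_le_one w
  have hF' : ∀ u ∈ TWF C τ, ¬ (s ≤ u ∧ (u : ℝ) < pt w) := by
    rintro u hu ⟨h1, h2⟩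
    have := hcF u hu h2
    have h1 : (s : ℝ) ≤ u := h1
    linarith
  have comp : icof s (pt w) z - ind s z + ind y z = 1 ∧
      ((s : ℝ) < pt (τ z).base ∧ pt (τ z).base ≤ pt w) ∨
      icof s (pt w) z - ind s z + ind y z = 0 ∧
      ¬ ((s : ℝ) < pt (τ z).base ∧ pt (τ z).base ≤ pt w) := by
    by_cases hzy : z = y
    · subst hzy
      left
      have hnot : ¬ (s ≤ z ∧ (z : ℝ) < pt w) := by
        rcases TWF_cases (τ := τ) z hz with ⟨h1, _⟩ | h1
        · exact hF' z h1
        · rintro ⟨h2, h3⟩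
          have h2 : (s : ℝ) ≤ z := h2
          have : w = z := by rw [hw, h1]; rfl
          rw [this] at h3
          rcases pt_eq_or z with ⟨h4, _⟩ | ⟨_, h4⟩ <;> linarith
      have hzs : z ≠ s := by
        rintro rfl
        exact hnot ⟨le_rfl, hsw⟩
      rw [icof_zero hnot, ind_ne hzs, ind_self]
      exact ⟨by norm_num, hsw, le_rfl⟩
    · have hww : pt (τ z).base ≠ pt w := by
        intro heq
        apply hzy
        apply h.inj z hz y hy
        have := pt_injective heq
        exact congrArg toL this
      rw [ind_ne hzy]
      rcases TWF_cases (τ := τ) z hz with ⟨h1, h2⟩ | h1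
      · right
        have hzs : z ≠ s := by
          rintro rfl
          exact hF' _ h1 ⟨le_rfl, hsw⟩
        rw [icof_zero (hF' z h1), ind_ne hzs]
        refine ⟨by norm_num, ?_⟩
        rintro ⟨h3, h4⟩
        have h5 := lt_of_le_of_ne h4 hww
        rcases pt_eq_or (τ z).base with ⟨_, h6⟩ | ⟨_, h6⟩
        · linarith
        · exact hF' _ h2 ⟨show (s : ℝ) ≤ (τ z).base by linarith, by linarith⟩
      · have hb : (τ z).base = z := by rw [h1]; rfl
        rw [hb] at hww ⊢
        rcases pt_eq_or z with ⟨h5, h6⟩ | ⟨_, h6⟩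
        · right
          have hzs : z ≠ s := by
            rintro rfl
            linarith
          rw [ind_ne hzs, icof_zero (fun h' => by
            have : (s : ℝ) ≤ z := h'.1
            linarith)]
          refine ⟨by norm_num, fun h' => ?_⟩
          exact hww (by linarith [h'.2])
        · rw [h6] at hww ⊢
          by_cases hzs : z = s
          · right
            subst hzs
            rw [icof_one ⟨le_rfl, hsw⟩, ind_self]
            exact ⟨by norm_num, fun h' => lt_irrefl _ h'.1⟩
          · have hzs' : (z : ℝ) ≠ s := fun h' => hzs (Subtype.ext h')
            rw [ind_ne hzs]
            by_cases hin : s ≤ z ∧ (z : ℝ) < pt w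
            · left
              rw [icof_one hin]
              exact ⟨by norm_num, lt_of_le_of_ne hin.1 (Ne.symm hzs'), hin.2.le⟩
            · right
              rw [icof_zero hin]
              exact ⟨by norm_num, fun h' => hin ⟨show (s : ℝ) ≤ z from h'.1.le,
                lt_of_le_of_ne h'.2 hww⟩⟩
  apply icof_arc_aux
  · rcases comp with ⟨h1, h2⟩ | ⟨h1, h2⟩ <;> rw [h1] <;> simp only [h2] <;> simp
  · rcases comp with ⟨h1, h2⟩ | ⟨h1, h2⟩ <;> rw [h1] <;> simp only [h2] <;> simp

theorem finite_left {F : Set I01} (hF : F.Finite) (x : I01) :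
    ∃ c : ℝ, 0 ≤ c ∧ c < pt x ∧ ∀ u ∈ F, (u : ℝ) < pt x → (u : ℝ) ≤ c := by
  induction F, hF using Set.Finite.induction_on with
  | empty => exact ⟨0, le_rfl, pt_pos x, by simp⟩
  | @insert a s ha hs ih =>
    obtain ⟨c, h0, h1, h2⟩ := ih
    by_cases hap : (a : ℝ) < pt x
    · refine ⟨max c a, h0.trans (le_max_left _ _), max_lt h1 hap, ?_⟩
      rintro u (rfl | hu) hup
      · exact le_max_right _ _
      · exact (h2 u hu hup).trans (le_max_left _ _)
    · refine ⟨c, h0, h1, ?_⟩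
      rintro u (rfl | hu) hup
      · exact absurd hup hap
      · exact h2 u hu hup

theorem TW.sameC (h : TW C τ) {s t : I01} (hst : s < t)
    (hF : ∀ u ∈ TWF C τ, ¬ (s < u ∧ u ≤ t)) : s ∈ C ↔ t ∈ C :=
  bd_iff h.step hst (fun u hu => hF u (Or.inl (Or.inr hu)))

theorem exists_arc (h : TW C τ) {x : I01} (hx : x ∈ C) : ∀ y ∈ C, ∃ f, Arc C τ f x y := by
  let Y : Set I01 := {y | y ∈ C ∧ ∃ f, Arc C τ f x y}
  have hY : StepS Y := by
    refine ⟨TWF C τ, h.finF, fun s t hst hF => ?_⟩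
    have hsame := h.sameC hst hF
    have harc := arc1 hst hF
    apply propext
    constructor
    · rintro ⟨h1, f, hf⟩
      exact ⟨hsame.1 h1, _, hf.add harc⟩
    · rintro ⟨h1, f, hf⟩
      exact ⟨hsame.2 h1, _, hf.add harc.neg⟩
  have hYC : Y = C := by
    refine h.erg Y (fun y hy => hy.1) hY ?_ ⟨x, hx, _, Arc.refl x⟩
    intro y hy
    obtain ⟨c, hc0, hc1, hc2⟩ := finite_left h.finF (τ y).base
    obtain ⟨c', hc0', hc1', hc2'⟩ := mem_lf.1 (h.mem y hy)
    have harc : ∀ s : I01, max c c' < s → (s : ℝ) < pt (τ y).base →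
        s ∈ C ∧ Arc C τ (icof s (pt (τ y).base)) s y := by
      intro s h1 h2
      exact ⟨hc2' s ((le_max_right _ _).trans_lt h1) h2,
        arc2 h hy hc0 hc2 ((le_max_left _ _).trans_lt h1) h2⟩
    have hmem : {s : I01 | max c c' < s ∧ (s : ℝ) < pt (τ y).base} ∈ lf (τ y).base :=
      mem_lf.2 ⟨max c c', hc0.trans (le_max_left _ _), max_lt hc1 hc1', fun u h1 h2 => ⟨h1, h2⟩⟩
    constructor
    · rintro ⟨_, f, hf⟩
      show Y ∈ lf (τ y).base
      filter_upwards [hmem] with s hs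
      obtain ⟨h1, h2⟩ := harc s hs.1 hs.2
      exact ⟨h1, _, hf.add h2.neg⟩
    · intro hyY
      have hyY : Y ∈ lf (τ y).base := hyY
      obtain ⟨s, hs1, hs2⟩ := (lf_neBot _).nonempty_of_mem (Filter.inter_mem hyY hmem)
      obtain ⟨_, f, hf⟩ := hs1
      exact ⟨hy, _, hf.add (harc s hs2.1 hs2.2).2⟩
  intro y hy
  rw [← hYC] at hy
  exact hy.2

theorem arc_const (h : TW C τ) {f : I01 → ℤ} {x : I01} (hf : Arc C τ f x x) :
    ∀ y ∈ C, ∀ z ∈ C, f y = f z := by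
  intro y hy z hz
  have hX : {u | u ∈ C ∧ f u = f y} = C := by
    refine h.erg _ (fun u hu => hu.1) ?_ ?_ ⟨y, hy, rfl⟩
    · exact Step.map₂ h.step hf.1 (fun p q => p ∧ q = f y)
    · intro v hv
      have h1 : ∀ᶠ u in (τ v).fil, f u = f v := by
        filter_upwards [hf.2 v hv] with u hu
        rw [hu]; ring
      constructor
      · rintro ⟨_, h2⟩
        rw [mem_LX]
        filter_upwards [h1, h.mem v hv] with u hu1 hu2
        exact ⟨hu2, hu1.trans h2⟩
      · intro h2
        rw [mem_LX] at h2
        obtain ⟨u, ⟨_, hu1⟩, hu2⟩ := (fil_neBot _).nonempty_of_mem (Filter.inter_mem h2 h1)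
        have hu2 : f u = f v := hu2
        exact ⟨hv, hu2.symm.trans hu1⟩
  rw [← hX] at hz
  exact hz.2.symm

/-! integrals -/
open MeasureTheory

noncomputable def intC (C : Set I01) (f : I01 → ℤ) : ℝ := ∫ z in C, (f z : ℝ) ∂mI

theorem Step.integrableC {f : I01 → ℤ} (hf : Step f) (C : Set I01) :
    IntegrableOn (fun z => (f z : ℝ)) C mI := by
  have h1 : Step (fun z => (f z : ℝ)) := Step.map hf (fun n : ℤ => (n : ℝ))
  obtain ⟨M, hM⟩ := (h1.finite_range.image (fun r => ‖r‖)).bddAbove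
  refine Measure.integrableOn_of_bounded (M := M) (measure_ne_top _ _)
    h1.measurable.aestronglyMeasurable (Eventually.of_forall (fun z => ?_))
  exact hM ⟨_, ⟨z, rfl⟩, rfl⟩

theorem intC_add {f g : I01 → ℤ} (hf : Step f) (hg : Step g) :
    intC C (fun u => f u + g u) = intC C f + intC C g := by
  unfold intC
  rw [← integral_add (hf.integrableC C) (hg.integrableC C)]
  simp

theorem intC_neg (f : I01 → ℤ) : intC C (fun u => - f u) = - intC C f := by
  unfold intC
  rw [← integral_neg]
  simp

theorem intC_smul (f : I01 → ℤ) {g : IETG} (hg : g • C = C) :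
    intC C (fun u => f (g • u)) = intC C f := by
  unfold intC
  have hemb : MeasurableEmbedding (fun x : I01 => g • x) :=
    (MeasurableEquiv.mk (MulAction.toPerm g) (measurable_smul_IET g)
      (measurable_smul_IET g⁻¹)).measurableEmbedding
  have := (measurePreserving_smul_IET g).setIntegral_preimage_emb hemb (fun z => (f z : ℝ)) C
  rw [← this]
  have : (fun x : I01 => g • x) ⁻¹' C = C := by
    ext x
    constructor
    · intro h
      have h : g • x ∈ C := h
      rw [← hg] at h
      simpa using h
    · exact mem_of_fix hg
  rw [this]

/-- arcs of zero integral -/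
def Arc0 (C : Set I01) (τ : I01 → LI) (x y : I01) : Prop := ∃ f, Arc C τ f x y ∧ intC C f = 0

theorem Arc0.refl (x : I01) : Arc0 C τ x x := ⟨_, Arc.refl x, by simp [intC]⟩

theorem Arc0.trans {x y z : I01} (h1 : Arc0 C τ x y) (h2 : Arc0 C τ y z) : Arc0 C τ x z := by
  obtain ⟨f, hf, hf'⟩ := h1
  obtain ⟨g, hg, hg'⟩ := h2
  exact ⟨_, hf.add hg, by rw [intC_add hf.1 hg.1, hf', hg', add_zero]⟩

theorem Arc0.symm {x y : I01} (h1 : Arc0 C τ x y) : Arc0 C τ y x := by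
  obtain ⟨f, hf, hf'⟩ := h1
  exact ⟨_, hf.neg, by rw [intC_neg, hf', neg_zero]⟩

theorem Arc0.smul {x y : I01} (h1 : Arc0 C τ x y) {g : IETG} (hg : Eqv C τ g) :
    Arc0 C τ (g • x) (g • y) := by
  obtain ⟨f, hf, hf'⟩ := h1
  exact ⟨_, hf.smul hg, by rw [intC_smul f hg.inv.1, hf']⟩

theorem arc0_comm (h : TW C τ) {g k : IETG} (hg : Eqv C τ g) (hk : Eqv C τ k) {x : I01}
    (hx : x ∈ C) : Arc0 C τ (k • g • x) (g • k • x) := by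
  obtain ⟨f1, hf1⟩ := exists_arc h hx (g • x) (mem_of_fix hg.1 hx)
  obtain ⟨f2, hf2⟩ := exists_arc h hx (k • x) (mem_of_fix hk.1 hx)
  have h3 := hf1.add (hf2.smul hg)
  have h4 := hf2.add (hf1.smul hk)
  refine ⟨_, h4.neg.add h3, ?_⟩
  rw [intC_add h4.neg.1 h3.1, intC_neg, intC_add hf2.1 (hf1.smul hk).1,
    intC_add hf1.1 (hf2.smul hg).1, intC_smul f1 hk.inv.1, intC_smul f2 hg.inv.1]
  ring

theorem integral_aux {f : I01 → ℤ} {c : ℤ} {s t : I01} (hC : StepS C)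
    (hfval : ∀ z ∈ C, (f z : ℝ) = c + (icof s t z : ℝ)) (hsub : Set.Ico s t ⊆ C) :
    intC C f = c * (mI C).toReal + (mI (Set.Ico s t)).toReal := by
  have e1 : intC C f = ∫ z in C, ((c : ℝ) + (icof s t z : ℝ)) ∂mI :=
    setIntegral_congr_fun hC.measurable hfval
  rw [e1, integral_add (integrable_const _) ((icof_step s t).integrableC C)]
  congr 1
  · rw [setIntegral_const]
    rw [smul_eq_mul, mul_comm]; rfl
  · have e2 : (fun z => (icof s t z : ℝ)) = (Set.Ico s t).indicator (fun _ => (1 : ℝ)) := by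
      funext z
      by_cases hz : z ∈ Set.Ico s t
      · rw [Set.indicator_of_mem hz, icof_one hz]; simp
      · rw [Set.indicator_of_notMem hz, icof_zero hz]; simp
    rw [e2, setIntegral_indicator measurableSet_Ico, Set.inter_eq_right.2 hsub]
    simp [Measure.real]

theorem core2 (h : TW C τ) (hne : C.Nonempty) {g k : IETG} (hg : Eqv C τ g) (hk : Eqv C τ k) :
    ∃ p : ℕ, 0 < p ∧ ∃ x ∈ C, (g * k * g⁻¹ * k⁻¹) ^ p • x = x := by
  obtain ⟨x, hx⟩ := hne
  set w := g * k * g⁻¹ * k⁻¹ with hw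
  have hwE : Eqv C τ w := ((hg.mul hk).mul hg.inv).mul hk.inv
  set y := k • g • x with hy
  have hyC : y ∈ C := mem_of_fix hk.1 (mem_of_fix hg.1 hx)
  have hwy : Arc0 C τ y (w • y) := by
    have := arc0_comm h hg hk hx
    have e : w • y = g • k • x := by
      rw [hw, hy]
      simp only [mul_smul, inv_smul_smul]
    rw [e]; exact this
  by_contra hcon
  have hap : Ap w y := fun n hn h1 => hcon ⟨n, hn, y, hyC, h1⟩
  have hwC : ∀ n : ℕ, w ^ n • y ∈ C := fun n => mem_of_fix (fix_pow hwE.1 n) hyC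
  have harc0 : ∀ n : ℕ, Arc0 C τ y (w ^ n • y) := by
    intro n
    induction n with
    | zero => simpa using Arc0.refl y
    | succ n ih =>
      have := ih.smul hwE
      have e : w • w ^ n • y = w ^ (n + 1) • y := by rw [pow_succ']; exact (mul_smul w (w ^ n) y).symm
      rw [e] at this
      exact hwy.trans this
  -- two points of the orbit in the same piece
  have hF := h.finF
  have h0 : zeroI ∈ TWF C τ := Or.inr rfl
  choose q hq1 hq2 hq3 using fun n : ℕ => exists_greatest hF h0 (w ^ n • y)
  obtain ⟨i, j, hij, heq⟩ : ∃ i j : ℕ, w ^ i • y < w ^ j • y ∧ q i = q j := by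
    obtain ⟨i, j, hij, heq⟩ : ∃ i j : ℕ, i ≠ j ∧ q i = q j := by
      by_contra hcon2
      push Not at hcon2
      refine Set.infinite_of_injective_forall_mem (f := q) ?_ hq1 hF
      intro i j hij
      by_contra hne
      exact hcon2 i j hne hij
    have hne : w ^ i • y ≠ w ^ j • y := fun h' => hij (hap.pow_inj h')
    rcases lt_or_gt_of_ne hne with h' | h'
    · exact ⟨i, j, h', heq⟩
    · exact ⟨j, i, h', heq.symm⟩
  set s := w ^ i • y with hs
  set t := w ^ j • y with ht
  have hst : Arc0 C τ s t := (harc0 i).symm.trans (harc0 j)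
  have hFst : ∀ u ∈ TWF C τ, ¬ (s < u ∧ u ≤ t) := by
    rintro u hu ⟨h1, h2⟩
    have h3 := hq3 j u hu h2
    rw [← heq] at h3
    exact absurd (h1.trans_le (h3.trans (hq2 i))) (lt_irrefl _)
  have harc := arc1 hij hFst
  obtain ⟨f, hf, hf0⟩ := hst
  have hdiff := hf.add harc.neg
  have hconst := arc_const h hdiff
  set c : ℤ := f s + - icof s t s with hc
  have hfval : ∀ z ∈ C, (f z : ℝ) = c + (icof s t z : ℝ) := by
    intro z hz
    have := hconst z hz s (hwC i)
    have h2 : f z = c + icof s t z := by rw [hc]; linarith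
    rw [h2]; push_cast; ring
  have hsub : Set.Ico s t ⊆ C := by
    rintro z ⟨h1, h2⟩
    rcases h1.eq_or_lt with rfl | h1
    · exact hwC i
    · exact (h.sameC h1 (fun u hu hu' => hFst u hu ⟨hu'.1, hu'.2.trans h2.le⟩)).1 (hwC i)
  have hIntegral := integral_aux h.step hfval hsub
  rw [hf0, mI_Ico_I01] at hIntegral
  have hst' : (s : ℝ) < t := hij
  rw [ENNReal.toReal_ofReal (by linarith)] at hIntegral
  -- volume of C is bigger than t - s
  have hbig : (t : ℝ) - s < (mI C).toReal := by
    have hD : StepS (C ∩ (Set.Ico s t)ᶜ) := by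
      refine h.step.inter (StepS.compl ?_)
      have := (icof_step s t).map (fun n => n = 1)
      unfold StepS
      convert this using 2 with z
      constructor
      · intro hz; exact icof_one hz
      · intro hz
        by_contra hcon
        rw [icof_zero hcon] at hz
        exact absurd hz (by norm_num)
    have hpos := mI_pos_of_step hD ⟨t, hwC j, fun h' => lt_irrefl _ h'.2⟩
    have e : mI C = mI (Set.Ico s t) + mI (C ∩ (Set.Ico s t)ᶜ) := by
      have := measure_inter_add_sdiff (μ := mI) C (measurableSet_Ico (a := s) (b := t))
      rw [Set.inter_eq_right.2 hsub] at this
      exact this.symm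
    rw [e, ENNReal.toReal_add (measure_ne_top _ _) (measure_ne_top _ _), mI_Ico_I01,
      ENNReal.toReal_ofReal (by linarith)]
    have := ENNReal.toReal_pos hpos.ne' (measure_ne_top _ _)
    linarith
  rcases lt_or_ge c 0 with hneg | hpos
  · have : (c : ℝ) ≤ -1 := by exact_mod_cast (show c ≤ -1 by omega)
    nlinarith
  · have : (0 : ℝ) ≤ c := by exact_mod_cast hpos
    nlinarith

end

/-! ### Case 2: construction of the twisted left limit -/

def SG (a : IETG) (C : Set I01) : Set (LI × I01) := {e | e ∈ EC C ∧ End Dg a e}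

theorem CommS.compl {Γ : Type*} [Group Γ] {E : Type*} [MulAction Γ E] {D : Set E}
    (hD : CommS Γ D) : CommS Γ Dᶜ := by
  intro g
  refine ((hD g⁻¹).image (fun x => g⁻¹ • x)).subset ?_
  rintro e ⟨h1, h2⟩
  refine ⟨g • e, ⟨not_not.1 h2, ?_⟩, inv_smul_smul g e⟩
  rw [inv_smul_smul]; exact h1

section
variable {a : IETG} {C : Set I01}

theorem SG_smul (h : ∀ x ∈ C, Ap a x) {g : IETG} (hg : g • C = C) {k : ℕ} (hk : 0 < k)
    (hc : Commute (a ^ k) g) {e : LI × I01} (he : e ∈ SG a C) : g • e ∈ SG a C := by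
  have h1 : g • e ∈ EC C := (EC_smul hg).2 he.1
  have hap := Ap_EC h he.1
  refine ⟨h1, ?_⟩
  rw [← End.pow_iff Dg_comm (Ap_EC h h1) hk, End.comm_iff Dg_comm (hap.pow hk) hc,
    End.pow_iff Dg_comm hap hk]
  exact he.2

theorem SG_off_finite (h : ∀ x ∈ C, Ap a x) (hs : ∀ e ∈ EC C, End Dg a e ↔ End Dg a⁻¹ e) :
    (SG a C \ Dg).Finite := by
  refine (finite_trans (Dg_comm.compl) a).subset ?_
  rintro e ⟨⟨h1, h2⟩, h3⟩
  refine ⟨h3, Ap_EC h h1, ?_, ?_⟩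
  · intro h4
    obtain ⟨n, hn, hn'⟩ := (h2.and h4).exists
    exact hn' hn
  · intro h4
    obtain ⟨n, hn, hn'⟩ := (((hs e h1).1 h2).and h4).exists
    exact hn' hn

theorem SG_exists (h : Atom a C) (ha : a • C = C)
    (hs : ∀ e ∈ EC C, End Dg a e ↔ End Dg a⁻¹ e) {z : I01} (hz : z ∈ C) :
    ∃ x : LI, (x, z) ∈ SG a C := by
  have hB := finite_trans Dg_comm a
  have hB' : {u : I01 | (toL u, u) ∈
      {e : LI × I01 | e ∈ Dg ∧ Ap a e ∧ ¬ End Dg a e ∧ ¬ End Dg a⁻¹ e}}.Finite := by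
    refine Set.Finite.preimage (f := fun u : I01 => (toL u, u)) ?_ hB
    intro u _ v _ huv
    exact (Prod.ext_iff.1 huv).2
  obtain ⟨n, hn1, hn2⟩ := (((h.ap z hz).eventually (bd_finite h.step)).and
    ((h.ap z hz).eventually hB')).exists
  set z' := a ^ n • z with hz'
  have hzC : z' ∈ C := mem_of_fix (fix_pow ha n) hz
  have hL : toL z' ∈ LX C := by
    have : z' ∈ C ↔ toL z' ∈ LX C := not_not.1 hn1
    exact this.1 hzC
  have hEC : (toL z', z') ∈ EC C := ⟨hL, hzC⟩
  have hend : End Dg a (toL z', z') := by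
    by_contra hcon
    exact hn2 ⟨rfl, Ap_EC h.ap hEC, hcon, fun h' => hcon ((hs _ hEC).2 h')⟩
  have h3 : (a ^ n)⁻¹ • ((toL z', z') : LI × I01) ∈ SG a C :=
    SG_smul h.ap (fix_inv (fix_pow ha n)) (k := 1) one_pos
      (by rw [pow_one]; exact ((Commute.refl a).pow_right n).inv_right) ⟨hEC, hend⟩
  refine ⟨(a ^ n)⁻¹ • toL z', ?_⟩
  have e : (a ^ n)⁻¹ • ((toL z', z') : LI × I01) = ((a ^ n)⁻¹ • toL z', z) := by
    refine Prod.ext rfl ?_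
    show (a ^ n)⁻¹ • z' = z
    rw [hz', inv_smul_smul]
  rw [← e]; exact h3

theorem SG_unique1 {x x' : LI} {z : I01} (h1 : (x, z) ∈ SG a C) (h2 : (x', z) ∈ SG a C) :
    x = x' := by
  obtain ⟨n, hn, hn'⟩ := (h1.2.and h2.2).exists
  have e1 : a ^ n • x = toL (a ^ n • z) := hn
  have e2 : a ^ n • x' = toL (a ^ n • z) := hn'
  exact smul_left_cancel (a ^ n) (e1.trans e2.symm)

theorem SG_unique2 {x : LI} {z z' : I01} (h1 : (x, z) ∈ SG a C) (h2 : (x, z') ∈ SG a C) :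
    z = z' := by
  obtain ⟨n, hn, hn'⟩ := (h1.2.and h2.2).exists
  have e1 : a ^ n • x = toL (a ^ n • z) := hn
  have e2 : a ^ n • x = toL (a ^ n • z') := hn'
  exact smul_left_cancel (a ^ n) (toL_injective (e1.symm.trans e2))

theorem Eqv_of_SG {τ : I01 → LI} (hτ : ∀ z ∈ C, (τ z, z) ∈ SG a C) {g : IETG} (hg : g • C = C)
    (hgs : ∀ e ∈ SG a C, g • e ∈ SG a C) : Eqv C τ g := by
  refine ⟨hg, fun z hz => ?_⟩
  have h1 : ((g • τ z, g • z) : LI × I01) ∈ SG a C := hgs (τ z, z) (hτ z hz)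
  have h2 : ((τ (g • z), g • z) : LI × I01) ∈ SG a C := hτ (g • z) (mem_of_fix hg hz)
  exact SG_unique1 h2 h1

theorem TW_of_SG (h : Atom a C) (ha : a • C = C)
    (hs : ∀ e ∈ EC C, End Dg a e ↔ End Dg a⁻¹ e) {τ : I01 → LI}
    (hτ : ∀ z ∈ C, (τ z, z) ∈ SG a C) : TW C τ := by
  have hfin : {z | z ∈ C ∧ τ z ≠ toL z}.Finite := by
    refine ((SG_off_finite h.ap hs).image Prod.snd).subset ?_
    rintro z ⟨h1, h2⟩
    exact ⟨(τ z, z), ⟨hτ z h1, h2⟩, rfl⟩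
  have hE : Eqv C τ a := Eqv_of_SG hτ ha (fun e he =>
    SG_smul h.ap ha one_pos (by rw [pow_one]) he)
  have hEn : ∀ n : ℕ, Eqv C τ (a ^ n) := fun n => Eqv_of_SG hτ (fix_pow ha n) (fun e he =>
    SG_smul h.ap (fix_pow ha n) one_pos (by rw [pow_one]; exact (Commute.refl a).pow_right n) he)
  refine ⟨h.step, ?_, ?_, hfin, ?_⟩
  · intro z hz z' hz' e
    have h1 := hτ z hz
    rw [e] at h1
    exact SG_unique2 h1 (hτ z' hz')
  · intro z hz
    exact (hτ z hz).1.1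
  · intro X hXC hX hinv hne
    refine h.min X hXC hX ?_ hne
    have hF := finite_of_bd (hfin.union (bd_finite h.step))
    have key : ∀ n : ℕ, a ^ n • X ∈ {X | StepS X ∧ bd X ⊆
        {z | z ∈ C ∧ τ z ≠ toL z} ∪ bd C} := by
      intro n
      have hsub : a ^ n • X ⊆ C := by
        rw [← fix_pow ha n]; exact Set.smul_set_mono hXC
      refine ⟨hX.smul _, ?_⟩
      intro x hx
      by_cases hxC : x ∈ C
      · left
        refine ⟨hxC, fun e => hx ?_⟩
        have hi := (hEn n).inv
        have h2 : (a ^ n)⁻¹ • x ∈ C := mem_of_fix hi.1 hxC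
        have h3 := hinv _ h2
        rw [hi.2 x hxC, ← mem_LX_smul (g := a ^ n), smul_inv_smul,
          ← Set.mem_smul_set_iff_inv_smul_mem, e] at h3
        exact h3
      · right
        intro h4
        apply hx
        constructor
        · intro h5; exact absurd (hsub h5) hxC
        · intro h5; exact absurd (h4.2 (LX_mono hsub h5)) hxC
    obtain ⟨i, j, hij, heq⟩ : ∃ i j : ℕ, i < j ∧ a ^ i • X = a ^ j • X := by
      by_contra hcon2
      push Not at hcon2
      refine Set.infinite_of_injective_forall_mem (f := fun n : ℕ => a ^ n • X) ?_ key hF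
      intro i j hij
      rcases lt_trichotomy i j with h' | h' | h'
      · exact absurd hij (hcon2 i j h')
      · exact h'
      · exact absurd hij.symm (hcon2 j i h')
    refine ⟨j - i, by omega, ?_⟩
    have e : a ^ j = a ^ i * a ^ (j - i) := by rw [← pow_add]; congr 1; omega
    rw [e, mul_smul] at heq
    exact (smul_left_cancel _ heq).symm

end

theorem case2 (H N : Subgroup IETG) (hNH : N ≤ H) (hnorm : ∀ g ∈ H, ∀ n ∈ N, g * n * g⁻¹ ∈ N)
    (hpc : ∀ x ∈ N, ∀ y ∈ N, ∃ k : ℕ, 0 < k ∧ Commute (x ^ k) (y ^ k))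
    {a : IETG} (haN : a ∈ N) {C : Set I01} (h : Atom a C) (ha : a • C = C)
    (hs : ∀ e ∈ EC C, End Dg a e ↔ End Dg a⁻¹ e) :
    ∃ K : Subgroup IETG, K.relIndex (H ⊓ MulAction.stabilizer IETG C) ≠ 0 ∧
      ∀ g ∈ K, ∀ h ∈ K, ∃ p : ℕ, 0 < p ∧ ∃ x ∈ C, (g * h * g⁻¹ * h⁻¹) ^ p • x = x := by
  have hinv : ∀ g ∈ H ⊓ MulAction.stabilizer IETG C, ∀ e ∈ SG a C, g⁻¹ • e ∈ SG a C := by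
    rintro g ⟨hgH, hgC⟩ e he
    have hgC : g • C = C := hgC
    have hb := h.conj g
    rw [hgC] at hb
    obtain ⟨k, hk, hc⟩ := hpc _ (hnorm g hgH a haN) _ haN
    set b := g * a * g⁻¹ with hbdef
    have hbC : b • C = C := by rw [hbdef, mul_smul, mul_smul, fix_inv hgC, ha, hgC]
    have h1 : ∀ n : ℕ, (b ^ k) ^ n • e ∈ SG a C := fun n =>
      SG_smul h.ap (fix_pow (fix_pow hbC k) n) hk (hc.symm.pow_right n) he
    have hapb : Ap b e := Ap_EC hb.ap he.1
    have h2 : End Dg (b ^ k) e := by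
      have := (hapb.pow hk).eventually (SG_off_finite h.ap hs)
      refine this.mono (fun n hn => ?_)
      by_contra hcon
      exact hn ⟨h1 n, hcon⟩
    rw [End.pow_iff Dg_comm hapb hk] at h2
    have h3 : g⁻¹ • e ∈ EC C := (EC_smul (fix_inv hgC)).2 he.1
    refine ⟨h3, ?_⟩
    rw [← End.conj_iff Dg_comm (Ap_EC h.ap h3) g, smul_inv_smul]
    exact h2
  haveI : Nonempty LI := ⟨toL zeroI⟩
  choose! τ hτ using fun z (hz : z ∈ C) => SG_exists h ha hs hz
  have hTW := TW_of_SG h ha hs hτ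
  refine ⟨H ⊓ MulAction.stabilizer IETG C, by rw [Subgroup.relIndex_self]; exact one_ne_zero, ?_⟩
  have hE : ∀ g ∈ H ⊓ MulAction.stabilizer IETG C, Eqv C τ g := by
    intro g hg
    refine Eqv_of_SG hτ hg.2 (fun e he => ?_)
    have := hinv g⁻¹ (Subgroup.inv_mem _ hg) e he
    rwa [inv_inv] at this
  intro g hg k hk
  exact core2 hTW h.ne (hE g hg) (hE k hk)

theorem keyZ (H N : Subgroup IETG) (hNH : N ≤ H) (hnorm : ∀ g ∈ H, ∀ n ∈ N, g * n * g⁻¹ ∈ N)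
    (hcomm : ∀ g ∈ H, ∀ h ∈ H, g * h * g⁻¹ * h⁻¹ ∈ N)
    (hpc : ∀ x ∈ N, ∀ y ∈ N, ∃ k : ℕ, 0 < k ∧ Commute (x ^ k) (y ^ k))
    {a : IETG} (haN : a ∈ N) {C : Set I01} (h : Atom a C) :
    ∃ K : Subgroup IETG, K.relIndex (H ⊓ MulAction.stabilizer IETG C) ≠ 0 ∧
      ∀ g ∈ K, ∀ h ∈ K, ∃ p : ℕ, 0 < p ∧ ∃ x ∈ C, (g * h * g⁻¹ * h⁻¹) ^ p • x = x := by
  obtain ⟨k, hk, hkC⟩ := h.vi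
  have h1 := h.pow hk
  have haN1 : a ^ k ∈ N := N.pow_mem haN k
  generalize a ^ k = b at h1 haN1 hkC
  by_cases h2 : (SP b C).Nonempty
  · exact case1 H N hNH hnorm hcomm hpc haN1 h1 hkC h2
  by_cases h3 : (SP b⁻¹ C).Nonempty
  · exact case1 H N hNH hnorm hcomm hpc (N.inv_mem haN1) h1.inv (fix_inv hkC) h3
  refine case2 H N hNH hnorm hpc haN1 h1 hkC (fun e he => ⟨fun h4 => ?_, fun h4 => ?_⟩)
  · by_contra h5
    exact h2 ⟨e, he, h4, h5⟩
  · by_contra h5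
    exact h3 ⟨e, he, h4, by rwa [inv_inv]⟩

/-! ### Finiteness of the set of atoms and conclusion -/

def CA (N : Subgroup IETG) : Set (Set I01) := {C | ∃ n ∈ N, Atom n C}

section
variable {H N : Subgroup IETG}

theorem CA.disj (hpc : ∀ x ∈ N, ∀ y ∈ N, ∃ k : ℕ, 0 < k ∧ Commute (x ^ k) (y ^ k))
    {C D : Set I01} (hC : C ∈ CA N) (hD : D ∈ CA N) (hne : (C ∩ D).Nonempty) : C = D := by
  obtain ⟨n, hn, hnC⟩ := hC
  obtain ⟨m, hm, hmD⟩ := hD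
  obtain ⟨k, hk, hc⟩ := hpc n hn m hm
  exact hnC.overlap hmD hk hc hne

theorem CA.smul (hnorm : ∀ g ∈ H, ∀ n ∈ N, g * n * g⁻¹ ∈ N) {C : Set I01} (hC : C ∈ CA N)
    {g : IETG} (hg : g ∈ H) : g • C ∈ CA N := by
  obtain ⟨n, hn, hnC⟩ := hC
  exact ⟨_, hnorm g hg n hn, hnC.conj g⟩

theorem CA.orbit_finite (hnorm : ∀ g ∈ H, ∀ n ∈ N, g * n * g⁻¹ ∈ N)
    (hpc : ∀ x ∈ N, ∀ y ∈ N, ∃ k : ℕ, 0 < k ∧ Commute (x ^ k) (y ^ k)) {C : Set I01}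
    (hC : C ∈ CA N) : {D | ∃ g ∈ H, D = g • C}.Finite := by
  have hC' := hC
  obtain ⟨n, hn, hnC⟩ := hC'
  refine finite_of_disjoint hnC.step hnC.ne ?_ ?_
  · rintro X ⟨g, -, e⟩
    exact ⟨g, e⟩
  · rintro X ⟨g, hg, rfl⟩ Y ⟨g', hg', rfl⟩ hne
    exact CA.disj hpc (CA.smul hnorm hC hg) (CA.smul hnorm hC hg') hne

def DS (S : Set IETG) : Set I01 :=
  (⋃ s ∈ S, ({x | s • toL x ≠ toL (s • x)} ∪ {x | s⁻¹ • toL x ≠ toL (s⁻¹ • x)})) ∪ {zeroI}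

theorem DS_finite {S : Set IETG} (hS : S.Finite) : (DS S).Finite := by
  refine Set.Finite.union (hS.biUnion (fun s _ => ?_)) (Set.finite_singleton _)
  exact (smul_toL_finite s).union (smul_toL_finite s⁻¹)

theorem CA.touch {S : Set IETG} (hS : Subgroup.closure S = H) (hNH : N ≤ H)
    {C : Set I01} (hC : C ∈ CA N) :
    ∃ g ∈ H, ∃ f ∈ DS S, f ∈ g • C ∨ toL f ∈ LX (g • C) := by
  by_contra hcon
  push Not at hcon
  have key : ∀ h ∈ Subgroup.closure S, ∀ x : I01, (x ∈ C ∨ toL x ∈ LX C) →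
      h • toL x = toL (h • x) := by
    have step : ∀ s : IETG, (∀ x : I01, x ∉ DS S → s • toL x = toL (s • x)) →
        ∀ y ∈ H, (∀ x : I01, (x ∈ C ∨ toL x ∈ LX C) → y • toL x = toL (y • x)) →
        ∀ x : I01, (x ∈ C ∨ toL x ∈ LX C) → (s * y) • toL x = toL ((s * y) • x) := by
      intro s hs y hy ih x hx
      rw [mul_smul, mul_smul, ih x hx]
      apply hs
      intro hf
      obtain ⟨h1, h2⟩ := hcon y hy _ hf
      rcases hx with hx | hx
      · exact h1 (Set.smul_mem_smul_set hx)
      · apply h2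
        rw [← ih x (Or.inr hx)]
        exact mem_LX_smul.2 hx
    intro h hh
    induction hh using Subgroup.closure_induction_left with
    | one => intro x _; simp
    | mul_left s hs y hy ih =>
      refine step s (fun x hx => ?_) y (hS ▸ hy) ih
      by_contra hne
      exact hx (Or.inl (Set.mem_biUnion hs (Or.inl hne)))
    | inv_mul_cancel s hs y hy ih =>
      refine step s⁻¹ (fun x hx => ?_) y (hS ▸ hy) ih
      by_contra hne
      exact hx (Or.inl (Set.mem_biUnion hs (Or.inr hne)))
  obtain ⟨n, hn, hnC⟩ := hC
  obtain ⟨k, hk, hkC⟩ := hnC.vi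
  have h0 : zeroI ∉ C := by
    have := (hcon 1 H.one_mem zeroI (Or.inr rfl)).1
    rwa [one_smul] at this
  have hb : (bd C).Nonempty := by
    rw [Set.nonempty_iff_ne_empty]
    intro hb
    rw [eq_univ_of_bd_empty hnC.step hb hnC.ne] at h0
    exact h0 trivial
  obtain ⟨x, hx⟩ := hb
  have hx2 : ¬ (x ∈ C ↔ toL x ∈ LX C) := hx
  have hx' : x ∈ C ∨ toL x ∈ LX C := by tauto
  have hap : Ap n (toL x, x) := by
    rcases hx' with h1 | h1
    · exact Ap.of_snd (hnC.ap x h1)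
    · exact Ap.of_fst (Ap_LX hnC.ap h1)
  refine not_end_bd hnC.step hk hkC hx hap (Eventually.of_forall (fun i => ?_))
  exact key (n ^ i) (hS ▸ hNH (N.pow_mem hn i)) x hx'

theorem CA.finite {S : Set IETG} (hSf : S.Finite) (hS : Subgroup.closure S = H) (hNH : N ≤ H)
    (hnorm : ∀ g ∈ H, ∀ n ∈ N, g * n * g⁻¹ ∈ N)
    (hpc : ∀ x ∈ N, ∀ y ∈ N, ∃ k : ℕ, 0 < k ∧ Commute (x ^ k) (y ^ k)) : (CA N).Finite := by
  have hT : (⋃ f ∈ DS S, ({D | D ∈ CA N ∧ f ∈ D} ∪ {D | D ∈ CA N ∧ toL f ∈ LX D})).Finite := by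
    refine (DS_finite hSf).biUnion (fun f _ => Set.Finite.union ?_ ?_)
    · apply Set.Subsingleton.finite
      rintro D ⟨h1, h2⟩ D' ⟨h3, h4⟩
      exact CA.disj hpc h1 h3 ⟨f, h2, h4⟩
    · apply Set.Subsingleton.finite
      rintro D ⟨h1, h2⟩ D' ⟨h3, h4⟩
      refine CA.disj hpc h1 h3 (LX_nonempty (x := toL f) ?_)
      rw [LX_inter]; exact ⟨h2, h4⟩
  have hfin := hT.biUnion (t := fun D => {X | D ∈ CA N ∧ ∃ g ∈ H, X = g • D}) (fun D _ => by
    by_cases hD : D ∈ CA N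
    · exact (CA.orbit_finite hnorm hpc hD).subset (fun X hX => hX.2)
    · exact Set.finite_empty.subset (fun X hX => hD hX.1))
  refine hfin.subset (fun C hC => ?_)
  obtain ⟨g, hg, f, hf, h1⟩ := CA.touch hS hNH hC
  have hgC := CA.smul hnorm hC hg
  refine Set.mem_biUnion (x := g • C) ?_ ⟨hgC, g⁻¹, H.inv_mem hg, (inv_smul_smul g C).symm⟩
  refine Set.mem_biUnion hf ?_
  rcases h1 with h1 | h1
  · exact Or.inl ⟨hgC, h1⟩
  · exact Or.inr ⟨hgC, h1⟩

theorem va_of_pc (hfg : H.FG) (htf : ∀ g ∈ H, g ≠ 1 → ∀ k : ℕ, 0 < k → g ^ k ≠ 1) (hNH : N ≤ H)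
    (hnorm : ∀ g ∈ H, ∀ n ∈ N, g * n * g⁻¹ ∈ N)
    (hcomm : ∀ g ∈ H, ∀ h ∈ H, g * h * g⁻¹ * h⁻¹ ∈ N)
    (hpc : ∀ x ∈ N, ∀ y ∈ N, ∃ k : ℕ, 0 < k ∧ Commute (x ^ k) (y ^ k)) :
    ∃ K : Subgroup IETG, K.relIndex H ≠ 0 ∧ ∀ g ∈ K, ∀ h ∈ K, Commute g h := by
  obtain ⟨S, hS⟩ := hfg
  have hfin := CA.finite S.finite_toSet hS hNH hnorm hpc
  have hK : ∀ C : CA N, ∃ K : Subgroup IETG, K.relIndex H ≠ 0 ∧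
      ∀ g ∈ K, ∀ h ∈ K, ∃ p : ℕ, 0 < p ∧ ∃ x ∈ (C : Set I01), (g * h * g⁻¹ * h⁻¹) ^ p • x = x := by
    rintro ⟨C, hC⟩
    have hst := relIndex_stab H C (CA.orbit_finite hnorm hpc hC)
    obtain ⟨n, hn, hnC⟩ := hC
    obtain ⟨K, hK1, hK2⟩ := keyZ H N hNH hnorm hcomm hpc hn hnC
    refine ⟨K, Subgroup.relIndex_ne_zero_trans hK1 ?_, hK2⟩
    rw [Subgroup.inf_relIndex_left]; exact hst
  choose K hK1 hK2 using hK
  haveI : Finite (CA N) := hfin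
  refine ⟨H ⊓ ⨅ C, K C, ?_, ?_⟩
  · rw [Subgroup.inf_relIndex_left]
    exact Subgroup.relIndex_iInf_ne_zero hK1
  · intro g hg h hh
    have hw : g * h * g⁻¹ * h⁻¹ ∈ N := hcomm g hg.1 h hh.1
    by_contra hne
    have hne1 : g * h * g⁻¹ * h⁻¹ ≠ 1 := by
      intro h1
      apply hne
      have : g * h = h * g := by
        rw [mul_inv_eq_one, mul_inv_eq_iff_eq_mul] at h1
        exact h1
      exact this
    obtain ⟨C, hC⟩ := exists_atom _ (htf _ (hNH hw) hne1)
    have hCA : C ∈ CA N := ⟨_, hw, hC⟩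
    obtain ⟨p, hp, x, hx, hfix⟩ := hK2 ⟨C, hCA⟩ g ((Subgroup.mem_iInf.1 hg.2) ⟨C, hCA⟩) h
      ((Subgroup.mem_iInf.1 hh.2) ⟨C, hCA⟩)
    exact hC.ap x hx p hp hfix

end

theorem iter_mono {G : Type*} [Group G] (d : ℕ) : ∀ {K L : Subgroup G}, K ≤ L →
    (fun M : Subgroup G => ⁅M, M⁆)^[d] K ≤ (fun M : Subgroup G => ⁅M, M⁆)^[d] L := by
  induction d with
  | zero => intro K L h; exact h
  | succ d ih =>
    intro K L h
    rw [Function.iterate_succ_apply, Function.iterate_succ_apply]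
    exact ih (Subgroup.commutator_mono h h)

theorem iter_derived {G : Type*} [Group G] (H : Subgroup G) (d : ℕ) :
    (fun M : Subgroup G => ⁅M, M⁆)^[d] H = (derivedSeries H d).map H.subtype := by
  induction d with
  | zero =>
    rw [derivedSeries_zero, ← MonoidHom.range_eq_map, Subgroup.range_subtype]
    rfl
  | succ d ih =>
    rw [Function.iterate_succ_apply', ih, derivedSeries_succ, Subgroup.map_commutator]

theorem va_main (d : ℕ) : ∀ H : Subgroup IETG, H.FG →
    (∀ g ∈ H, g ≠ 1 → ∀ k : ℕ, 0 < k → g ^ k ≠ 1) →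
    (fun M : Subgroup IETG => ⁅M, M⁆)^[d] H = ⊥ →
    ∃ K : Subgroup IETG, K.relIndex H ≠ 0 ∧ ∀ g ∈ K, ∀ h ∈ K, Commute g h := by
  induction d with
  | zero =>
    intro H _ _ h
    have h : H = ⊥ := h
    refine ⟨⊥, by rw [h, Subgroup.relIndex_self]; exact one_ne_zero, ?_⟩
    intro g hg k _
    rw [Subgroup.mem_bot.1 hg]
    exact Commute.one_left k
  | succ d ih =>
    intro H hfg htf h
    rw [Function.iterate_succ_apply] at h
    have hNH : ⁅H, H⁆ ≤ H := by
      rw [Subgroup.commutator_le]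
      intro g hg k hk
      exact H.mul_mem (H.mul_mem (H.mul_mem hg hk) (H.inv_mem hg)) (H.inv_mem hk)
    have hcomm : ∀ g ∈ H, ∀ h ∈ H, g * h * g⁻¹ * h⁻¹ ∈ ⁅H, H⁆ :=
      fun g hg k hk => Subgroup.commutator_mem_commutator hg hk
    refine va_of_pc hfg htf hNH ?_ hcomm ?_
    · intro g hg n hn
      have := (⁅H, H⁆).mul_mem (hcomm g hg n (hNH hn)) hn
      rwa [inv_mul_cancel_right] at this
    · intro x hx y hy
      have hle : Subgroup.closure {x, y} ≤ ⁅H, H⁆ := by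
        rw [Subgroup.closure_le]
        rintro z (rfl | rfl)
        · exact hx
        · exact hy
      obtain ⟨K, hK1, hK2⟩ := ih (Subgroup.closure {x, y})
        ((Subgroup.fg_iff _).2 ⟨_, rfl, (Set.finite_singleton y).insert x⟩)
        (fun g hg => htf g (hNH (hle hg)))
        (le_bot_iff.1 (h ▸ iter_mono d hle))
      obtain ⟨m, hm, -, hm'⟩ := Subgroup.exists_pow_mem_of_relIndex_ne_zero hK1
        (Subgroup.subset_closure (Set.mem_insert x {y}))
      obtain ⟨n, hn, -, hn'⟩ := Subgroup.exists_pow_mem_of_relIndex_ne_zero hK1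
        (Subgroup.subset_closure (Set.mem_insert_of_mem x rfl : y ∈ ({x, y} : Set IETG)))
      refine ⟨m * n, Nat.mul_pos hm hn, hK2 _ ?_ _ ?_⟩
      · rw [pow_mul]; exact K.pow_mem hm'.1 n
      · rw [mul_comm, pow_mul]; exact K.pow_mem hn'.1 m

theorem va_final
    (G : Subgroup (Equiv.Perm I01)) (hG : ∀ g ∈ G, IsIET g)
    (hfg : Group.FG ↥G) (hsolv : IsSolvable ↥G)
    (htf : ∀ g ∈ G, g ≠ 1 → ¬ IsOfFinOrder g) :
    ∃ A : Subgroup ↥G, A.FiniteIndex ∧ ∀ a b : ↥A, a * b = b * a := by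
  have hle : G ≤ IETG := fun g hg => ⟨(hG g hg).pw, (hG _ (G.inv_mem hg)).pw⟩
  let φ : ↥(G.subgroupOf IETG) ≃* ↥G := Subgroup.subgroupOfEquivOfLe hle
  have h1 : (G.subgroupOf IETG).FG := by
    rw [← Group.fg_iff_subgroup_fg]
    exact Group.fg_of_surjective (f := φ.symm.toMonoidHom) φ.symm.surjective
  have hsolv' : Group.IsSolvable ↥G := hsolv
  have h2 : Group.IsSolvable ↥(G.subgroupOf IETG) :=
    Group.isSolvable_of_surjective (f := φ.symm.toMonoidHom) φ.symm.surjective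
  obtain ⟨d, hd⟩ := h2
  have h3 : ∀ g ∈ G.subgroupOf IETG, g ≠ 1 → ∀ k : ℕ, 0 < k → g ^ k ≠ 1 := by
    intro g hg hne k hk hgk
    refine htf g.1 hg (fun e => hne (Subtype.ext e)) ?_
    rw [isOfFinOrder_iff_pow_eq_one]
    exact ⟨k, hk, congrArg Subtype.val hgk⟩
  have h4 : (fun M : Subgroup IETG => ⁅M, M⁆)^[d] (G.subgroupOf IETG) = ⊥ := by
    rw [iter_derived, hd, Subgroup.map_bot]
  obtain ⟨K, hK1, hK2⟩ := va_main d (G.subgroupOf IETG) h1 h3 h4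
  refine ⟨(K.subgroupOf (G.subgroupOf IETG)).comap φ.symm.toMonoidHom, ⟨?_⟩, ?_⟩
  · rw [Subgroup.index_comap_of_surjective _ φ.symm.surjective]
    exact hK1
  · rintro ⟨a, ha⟩ ⟨b, hb⟩
    apply Subtype.ext
    show a * b = b * a
    apply φ.symm.injective
    rw [map_mul, map_mul]
    apply Subtype.ext
    exact hK2 _ ha _ hb

end IETProof

/-- Every finitely generated torsion-free solvable subgroup of `IET` is virtually abelian. -/
theorem fg_torsionFree_solvable_subgroup_of_IET_is_virtually_abelian
    (G : Subgroup (Equiv.Perm I01)) (hG : ∀ g ∈ G, IsIET g)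
    (hfg : Group.FG ↥G) (hsolv : IsSolvable ↥G)
    (htf : ∀ g ∈ G, g ≠ 1 → ¬ IsOfFinOrder g) :
    ∃ A : Subgroup ↥G, A.FiniteIndex ∧ ∀ a b : ↥A, a * b = b * a := by
  exact va_final G hG hfg hsolv htf
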